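/- arXiv:1710.08722 — 2 statements merged into one kernel-verified Lean document; each statement's English description precedes it below -/
import Mathlib

section
/- For every C₀ > 0 there exists a constant C depending only on C₀ such that for every s ∈ (1/2,1) the following holds. Let L > 0 and let γ₀ be a closed simple arc-length curve on S² of length L with unit normal ν(t) := γ₀(t) × γ₀'(t). Assume ∫_0^L ∫_0^L |ν(t)−ν(t̄)|² k_s(γ₀(t), γ₀(t̄)) dt dt̄ ≤ C₀ L and L ≤ C₀/(1−s). Then L ≤ C. -/
open MeasureTheory
open scoped ENNReal RealInnerProductSpace

noncomputable section

abbrev E3 := EuclideanSpace ℝ (Fin 3)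

/-- Cross product in `ℝ³` (Euclidean). -/
def cross (a b : E3) : E3 :=
  (WithLp.equiv 2 (Fin 3 → ℝ)).symm
    ![a 1 * b 2 - a 2 * b 1, a 2 * b 0 - a 0 * b 2, a 0 * b 1 - a 1 * b 0]

/-- The kernel `k_s(x̂,ŷ) = ∫_0^∞ t (t² + 1 − 2t x̂·ŷ)^{−(3+s)/2} dt ∈ [0,∞]`. -/
def kernelK (s : ℝ) (x y : E3) : ℝ≥0∞ :=
  ∫⁻ t in Set.Ioi (0:ℝ), ENNReal.ofReal (t * (t ^ 2 + 1 - 2 * t * ⟪x, y⟫) ^ (-(3 + s)/2))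

lemma exists_lift_aux (F : ℝ × ℝ → ℂ) (D : Set (ℝ × ℝ)) (hDo : IsOpen D) (hDc : Convex ℝ D)
    (hDn : D.Nonempty) (hF : ContinuousOn F D) (hne : ∀ p ∈ D, F p ≠ 0) :
    ∃ ψ : ℝ × ℝ → ℝ, ContinuousOn ψ D ∧ ∀ p ∈ D, ∃ r : ℝ, 0 < r ∧
      (F p).re = r * Real.cos (2 * Real.pi * ψ p) ∧ (F p).im = r * Real.sin (2 * Real.pi * ψ p) := by
  have : ContractibleSpace D := hDc.contractibleSpace hDn
  have : LocallyPathConnectedSpace D := hDo.locallyPathConnectedSpace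
  classical
  obtain ⟨p0, hp0⟩ := hDn
  have h := Complex.isCoveringMapOn_exp.existsUnique_continuousMap_lifts
    ⟨D.domRestrict F, hF.domRestrict⟩ (a₀ := ⟨p0, hp0⟩) (e₀ := Complex.log (F p0))
    (by simp [Complex.exp_log (hne p0 hp0)]) (by intro p; simpa using hne p.1 p.2)
  obtain ⟨Φ, ⟨-, hΦ⟩, -⟩ := h
  refine ⟨fun p => if h : p ∈ D then (Φ ⟨p, h⟩).im / (2 * Real.pi) else 0, ?_, ?_⟩
  · rw [continuousOn_iff_continuous_domRestrict]
    have : Continuous fun p : D => (Φ p).im / (2 * Real.pi) := by fun_prop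
    refine this.congr ?_
    intro p
    simp [Set.domRestrict]
  · intro p hp
    have h1 : Complex.exp (Φ ⟨p, hp⟩) = F p := congrFun hΦ ⟨p, hp⟩
    refine ⟨Real.exp (Φ ⟨p, hp⟩).re, Real.exp_pos _, ?_, ?_⟩
    · beta_reduce
      rw [← h1, Complex.exp_re, dif_pos hp, mul_div_cancel₀ _ (by positivity)]
    · beta_reduce
      rw [← h1, Complex.exp_im, dif_pos hp, mul_div_cancel₀ _ (by positivity)]

lemma floor_const_aux {X : Type*} [TopologicalSpace X] {S : Set X} (hS : IsPreconnected S)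
    {f : X → ℝ} (hf : ContinuousOn f S) (hn : ∀ x ∈ S, ∀ n : ℤ, f x ≠ n) :
    ∀ x ∈ S, ∀ y ∈ S, ⌊f x⌋ = ⌊f y⌋ := by
  have key : ∀ x ∈ S, ∀ y ∈ S, ⌊f x⌋ < ⌊f y⌋ → False := by
    intro x hx y hy h
    have h1 : (⌊f y⌋ : ℝ) ∈ Set.Icc (f x) (f y) :=
      ⟨(Int.lt_floor_add_one (f x)).le.trans (by exact_mod_cast h), Int.floor_le _⟩
    obtain ⟨z, hz, hz'⟩ := hS.intermediate_value hx hy hf h1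
    exact hn z hz _ hz'
  intro x hx y hy
  rcases lt_trichotomy ⌊f x⌋ ⌊f y⌋ with h | h | h
  · exact (key x hx y hy h).elim
  · exact h
  · exact (key y hy x hx h).elim

lemma int_of_cos_sin_aux {x : ℝ} (hc : 0 < Real.cos (2 * Real.pi * x))
    (hs : Real.sin (2 * Real.pi * x) = 0) : ∃ n : ℤ, x = n := by
  have h1 : Real.cos (2 * Real.pi * x) = 1 := by
    have := Real.sin_sq_add_cos_sq (2 * Real.pi * x)
    rw [hs] at this
    nlinarith
  obtain ⟨n, hn⟩ := (Real.cos_eq_one_iff _).1 h1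
  refine ⟨n, ?_⟩
  have hp := Real.pi_pos
  have : (2 * Real.pi) * (n - x) = 0 := by linarith
  rcases mul_eq_zero.1 this with h | h
  · linarith
  · linarith

lemma floor_pos_aux {x : ℝ} (hc : 0 < Real.cos (2 * Real.pi * x)) :
    ⌊x - 1/4⌋ = ⌊x + 1/4⌋ - 1 := by
  set m := ⌊x + 1/4⌋ with hm
  have h1 : (m:ℝ) ≤ x + 1/4 := Int.floor_le _
  have h2 : x + 1/4 < m + 1 := Int.lt_floor_add_one _
  have hp := Real.pi_pos
  have h3 : x < m + 1/4 := by
    by_contra hcon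
    push Not at hcon
    have h4 : Real.cos (2 * Real.pi * x) = Real.cos (2 * Real.pi * x - m * (2 * Real.pi)) := by
      rw [Real.cos_sub_int_mul_two_pi]
    have h5 : Real.cos (2 * Real.pi * x - m * (2 * Real.pi)) ≤ 0 := by
      apply Real.cos_nonpos_of_pi_div_two_le_of_le <;> nlinarith
    linarith
  rw [Int.floor_eq_iff]
  push_cast
  constructor <;> linarith

lemma planar_aux (w : ℝ → ℂ) (L : ℝ) (hw : Continuous w)
    (hper : ∀ t, w (t + L) = w t) (hinj : ∀ t u, t < u → u < t + L → w t ≠ w u)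
    (a b : ℝ) (hab : a < b) (hba : b < a + L) (ha : (w a).re = 0) (hb : (w b).re = 0)
    (hmm : ∀ t, (w t).re = 0 → (w a).im ≤ (w t).im ∧ (w t).im ≤ (w b).im)
    (η : ℝ) (hη : 0 < η) (hηL : 2 * η < L)
    (ha1 : ∀ t, a - η ≤ t → t < a → (w t).re < 0) (ha2 : ∀ t, a < t → t ≤ a + η → 0 < (w t).re)
    (hb1 : ∀ t, b - η ≤ t → t < b → (w t).re < 0) (hb2 : ∀ t, b < t → t ≤ b + η → 0 < (w t).re) :
    False := by
  set D : Set (ℝ × ℝ) := {p | p.1 < p.2 ∧ p.2 < p.1 + L} with hD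
  set F : ℝ × ℝ → ℂ := fun p => w p.2 - w p.1 with hF
  have hDo : IsOpen D := by
    apply IsOpen.inter
    · exact isOpen_lt continuous_fst continuous_snd
    · exact isOpen_lt continuous_snd (by fun_prop)
  have hDc : Convex ℝ D := by
    intro p hp q hq x y hx hy hxy
    simp only [hD, Set.mem_ofPred_eq, Prod.fst_add, Prod.snd_add, Prod.smul_fst, Prod.smul_snd,
      smul_eq_mul] at *
    obtain ⟨p1, p2⟩ := hp
    obtain ⟨q1, q2⟩ := hq
    have hx' : x = 1 - y := by linarith
    subst hx'
    constructor
    · rcases hx.eq_or_lt with h | h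
      · rw [← h]
        have : y = 1 := by linarith
        subst this; linarith
      · nlinarith
    · rcases hx.eq_or_lt with h | h
      · rw [← h]
        have : y = 1 := by linarith
        subst this; linarith
      · nlinarith
  have hmemD : ∀ t u, t < u → u < t + L → (t, u) ∈ D := fun t u h1 h2 => ⟨h1, h2⟩
  obtain ⟨ψ, hψ, hψF⟩ := exists_lift_aux F D hDo hDc ⟨(a, b), hmemD _ _ hab hba⟩
    (by fun_prop) (fun p hp => sub_ne_zero.2 (hinj _ _ hp.1 hp.2).symm)
  have hp := Real.pi_pos
  have e1 : ∀ x : ℝ, Real.cos (2 * Real.pi * (x - 1/4)) = Real.sin (2 * Real.pi * x) := by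
    intro x
    rw [show 2 * Real.pi * (x - 1/4) = 2 * Real.pi * x - Real.pi / 2 by ring, Real.cos_sub_pi_div_two]
  have e2 : ∀ x : ℝ, Real.sin (2 * Real.pi * (x - 1/4)) = - Real.cos (2 * Real.pi * x) := by
    intro x
    rw [show 2 * Real.pi * (x - 1/4) = 2 * Real.pi * x - Real.pi / 2 by ring, Real.sin_sub_pi_div_two]
  have e3 : ∀ x : ℝ, Real.cos (2 * Real.pi * (x + 1/4)) = - Real.sin (2 * Real.pi * x) := by
    intro x
    rw [show 2 * Real.pi * (x + 1/4) = 2 * Real.pi * x + Real.pi / 2 by ring, Real.cos_add_pi_div_two]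
  have e4 : ∀ x : ℝ, Real.sin (2 * Real.pi * (x + 1/4)) = Real.cos (2 * Real.pi * x) := by
    intro x
    rw [show 2 * Real.pi * (x + 1/4) = 2 * Real.pi * x + Real.pi / 2 by ring, Real.sin_add_pi_div_two]
  have ci : ∀ n : ℤ, Real.cos (2 * Real.pi * n) = 1 := by
    intro n; rw [mul_comm]; exact Real.cos_int_mul_two_pi n
  have si : ∀ n : ℤ, Real.sin (2 * Real.pi * n) = 0 := by
    intro n
    have := Real.sin_int_mul_pi (2 * n)
    push_cast at this
    rw [← this]; ring_nf
  have hdown : ∀ p ∈ D, ¬((F p).re = 0 ∧ (F p).im < 0) → ∀ n : ℤ, ψ p + 1/4 ≠ n := by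
    intro p hpD hno n hn
    obtain ⟨r, hr, h1, h2⟩ := hψF p hpD
    have h3 := e3 (ψ p); have h4 := e4 (ψ p)
    rw [hn, ci] at h3
    rw [hn, si] at h4
    apply hno
    rw [h1, h2, ← h4, show Real.sin (2 * Real.pi * ψ p) = -1 by linarith]
    constructor <;> linarith
  have hup : ∀ p ∈ D, ¬((F p).re = 0 ∧ 0 < (F p).im) → ∀ n : ℤ, ψ p - 1/4 ≠ n := by
    intro p hpD hno n hn
    obtain ⟨r, hr, h1, h2⟩ := hψF p hpD
    have h3 := e1 (ψ p); have h4 := e2 (ψ p)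
    rw [hn, ci] at h3
    rw [hn, si] at h4
    apply hno
    rw [h1, h2, ← h3, show Real.cos (2 * Real.pi * ψ p) = 0 by linarith]
    constructor <;> linarith
  have hpos : ∀ p ∈ D, 0 < (F p).re → ⌊ψ p - 1/4⌋ = ⌊ψ p + 1/4⌋ - 1 := by
    intro p hpD h
    obtain ⟨r, hr, h1, h2⟩ := hψF p hpD
    rw [h1] at h
    exact floor_pos_aux (pos_of_mul_pos_right h hr.le)
  have hupval : ∀ p ∈ D, (F p).re = 0 → 0 < (F p).im → ψ p = ⌊ψ p + 1/4⌋ + 1/4 := by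
    intro p hpD h h'
    obtain ⟨r, hr, h1, h2⟩ := hψF p hpD
    rw [h1] at h
    rw [h2] at h'
    have h3 := pos_of_mul_pos_right h' hr.le
    have h4 : Real.cos (2 * Real.pi * ψ p) = 0 := (mul_eq_zero.1 h).resolve_left hr.ne'
    obtain ⟨n, hn⟩ := int_of_cos_sin_aux (x := ψ p - 1/4) (by rw [e1]; exact h3)
      (by rw [e2, h4]; simp)
    have : ⌊ψ p + 1/4⌋ = n := by
      rw [Int.floor_eq_iff]; constructor <;> linarith
    rw [this]; linarith
  have hdownval : ∀ p ∈ D, (F p).re = 0 → (F p).im < 0 → ψ p = ⌊ψ p - 1/4⌋ + 3/4 := by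
    intro p hpD h h'
    obtain ⟨r, hr, h1, h2⟩ := hψF p hpD
    rw [h1] at h
    rw [h2] at h'
    have h3 : Real.sin (2 * Real.pi * ψ p) < 0 := by
      by_contra hc
      push Not at hc
      nlinarith [mul_nonneg hr.le hc]
    have h4 : Real.cos (2 * Real.pi * ψ p) = 0 := (mul_eq_zero.1 h).resolve_left hr.ne'
    obtain ⟨n, hn⟩ := int_of_cos_sin_aux (x := ψ p + 1/4) (by rw [e3]; linarith)
      (by rw [e4, h4])
    have : ⌊ψ p - 1/4⌋ = n - 1 := by
      rw [Int.floor_eq_iff]; push_cast; constructor <;> linarith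
    rw [this]; push_cast; linarith
  -- the half-period symmetry
  have hsD : ∀ p ∈ D, (p.2, p.1 + L) ∈ D := fun p hp => ⟨hp.2, by linarith [hp.1]⟩
  have hsym : ∀ p ∈ D, ∃ n : ℤ, ψ (p.2, p.1 + L) - ψ p - 1/2 = n := by
    intro p hpD
    obtain ⟨r, hr, h1, h2⟩ := hψF p hpD
    obtain ⟨r', hr', h1', h2'⟩ := hψF _ (hsD p hpD)
    have hF' : F (p.2, p.1 + L) = - F p := by simp [hF, hper]
    rw [hF', Complex.neg_re] at h1'
    rw [hF', Complex.neg_im] at h2'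
    set A := 2 * Real.pi * ψ p
    set A' := 2 * Real.pi * ψ (p.2, p.1 + L)
    have hA : 2 * Real.pi * (ψ (p.2, p.1 + L) - ψ p - 1/2) = (A' - A) - Real.pi := by
      simp only [A, A']; ring
    have hsc := Real.sin_sq_add_cos_sq A
    apply int_of_cos_sin_aux
    · rw [hA, Real.cos_sub_pi, Real.cos_sub]
      have : r' * -(Real.cos A' * Real.cos A + Real.sin A' * Real.sin A) = r := by
        have : r' * -(Real.cos A' * Real.cos A + Real.sin A' * Real.sin A) =
          -(r' * Real.cos A') * Real.cos A - (r' * Real.sin A') * Real.sin A := by ring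
        rw [this, ← h1', ← h2', h1, h2]
        linear_combination r * hsc
      exact pos_of_mul_pos_right (this ▸ hr) hr'.le
    · rw [hA, Real.sin_sub_pi, Real.sin_sub]
      have : r' * -(Real.sin A' * Real.cos A - Real.cos A' * Real.sin A) = 0 := by
        have : r' * -(Real.sin A' * Real.cos A - Real.cos A' * Real.sin A) =
          -(r' * Real.sin A') * Real.cos A + (r' * Real.cos A') * Real.sin A := by ring
        rw [this, ← h1', ← h2', h1, h2]
        ring
      exact (mul_eq_zero.1 this).resolve_left hr'.ne'
  obtain ⟨k, hk⟩ : ∃ k : ℤ, ∀ p ∈ D, ψ (p.2, p.1 + L) = ψ p + k + 1/2 := by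
    obtain ⟨k, hk⟩ := hsym (a, b) (hmemD _ _ hab hba)
    refine ⟨k, fun p hpD => ?_⟩
    have hcont : ContinuousOn (fun p : ℝ × ℝ => ψ (p.2, p.1 + L) - ψ p) D := by
      refine ContinuousOn.sub ?_ hψ
      exact hψ.comp (by fun_prop) (fun p hp => hsD p hp)
    have := floor_const_aux hDc.isPreconnected hcont (by
      intro p hp n hn
      obtain ⟨j, hj⟩ := hsym p hp
      have h : ((2 * n - 1 : ℤ):ℝ) = ((2 * j : ℤ) : ℝ) := by push_cast; linarith
      have h' : 2 * n - 1 = 2 * j := by exact_mod_cast h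
      omega) p hpD (a, b) (hmemD _ _ hab hba)
    obtain ⟨j, hj⟩ := hsym p hpD
    have hj' : ⌊ψ (p.2, p.1 + L) - ψ p⌋ = j := by
      rw [Int.floor_eq_iff]; constructor <;> linarith
    have hk' : ⌊ψ (b, a + L) - ψ (a, b)⌋ = k := by
      simp only at hk
      rw [Int.floor_eq_iff]; constructor <;> linarith
    have hjk : j = k := by rw [← hj', ← hk', this]
    rw [← hjk]; linarith
  -- floor constant along segments
  have vd : ∀ t u₁ u₂, (∀ u ∈ Set.uIcc u₁ u₂, (t, u) ∈ D ∧ ¬((F (t, u)).re = 0 ∧ (F (t, u)).im < 0)) →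
      ⌊ψ (t, u₁) + 1/4⌋ = ⌊ψ (t, u₂) + 1/4⌋ := by
    intro t u₁ u₂ h
    refine floor_const_aux (S := Set.uIcc u₁ u₂) (f := fun u => ψ (t, u) + 1/4)
      isPreconnected_uIcc ?_ (fun u hu => hdown _ (h u hu).1 (h u hu).2) _
      Set.left_mem_uIcc _ Set.right_mem_uIcc
    exact (hψ.comp (by fun_prop) (fun u hu => (h u hu).1)).add continuousOn_const
  have hd : ∀ u t₁ t₂, (∀ t ∈ Set.uIcc t₁ t₂, (t, u) ∈ D ∧ ¬((F (t, u)).re = 0 ∧ (F (t, u)).im < 0)) →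
      ⌊ψ (t₁, u) + 1/4⌋ = ⌊ψ (t₂, u) + 1/4⌋ := by
    intro u t₁ t₂ h
    refine floor_const_aux (S := Set.uIcc t₁ t₂) (f := fun t => ψ (t, u) + 1/4)
      isPreconnected_uIcc ?_ (fun u hu => hdown _ (h u hu).1 (h u hu).2) _
      Set.left_mem_uIcc _ Set.right_mem_uIcc
    exact (hψ.comp (by fun_prop) (fun u hu => (h u hu).1)).add continuousOn_const
  have vu : ∀ t u₁ u₂, (∀ u ∈ Set.uIcc u₁ u₂, (t, u) ∈ D ∧ ¬((F (t, u)).re = 0 ∧ 0 < (F (t, u)).im)) →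
      ⌊ψ (t, u₁) - 1/4⌋ = ⌊ψ (t, u₂) - 1/4⌋ := by
    intro t u₁ u₂ h
    refine floor_const_aux (S := Set.uIcc u₁ u₂) (f := fun u => ψ (t, u) - 1/4)
      isPreconnected_uIcc ?_ (fun u hu => hup _ (h u hu).1 (h u hu).2) _
      Set.left_mem_uIcc _ Set.right_mem_uIcc
    exact (hψ.comp (by fun_prop) (fun u hu => (h u hu).1)).sub continuousOn_const
  have hu : ∀ u t₁ t₂, (∀ t ∈ Set.uIcc t₁ t₂, (t, u) ∈ D ∧ ¬((F (t, u)).re = 0 ∧ 0 < (F (t, u)).im)) →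
      ⌊ψ (t₁, u) - 1/4⌋ = ⌊ψ (t₂, u) - 1/4⌋ := by
    intro u t₁ t₂ h
    refine floor_const_aux (S := Set.uIcc t₁ t₂) (f := fun t => ψ (t, u) - 1/4)
      isPreconnected_uIcc ?_ (fun u hu => hup _ (h u hu).1 (h u hu).2) _
      Set.left_mem_uIcc _ Set.right_mem_uIcc
    exact (hψ.comp (by fun_prop) (fun u hu => (h u hu).1)).sub continuousOn_const
  have mem_seg : ∀ {x y z l r : ℝ}, z ∈ Set.uIcc x y → l < x → l < y → x < r → y < r → l < z ∧ z < r := by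
    intro x y z l r hz h1 h2 h3 h4
    rcases Set.mem_uIcc.1 hz with h | h
    · exact ⟨by linarith, by linarith⟩
    · exact ⟨by linarith, by linarith⟩
  -- avoided directions
  have nda : ∀ u, ¬((F (a, u)).re = 0 ∧ (F (a, u)).im < 0) := by
    rintro u ⟨h1, h2⟩
    simp only [hF, Complex.sub_re, Complex.sub_im, ha] at h1 h2
    linarith [(hmm u (by linarith)).1]
  have ndb : ∀ t, ¬((F (t, b)).re = 0 ∧ (F (t, b)).im < 0) := by
    rintro u ⟨h1, h2⟩
    simp only [hF, Complex.sub_re, Complex.sub_im, hb] at h1 h2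
    linarith [(hmm u (by linarith)).2]
  have nub : ∀ u, ¬((F (b, u)).re = 0 ∧ 0 < (F (b, u)).im) := by
    rintro u ⟨h1, h2⟩
    simp only [hF, Complex.sub_re, Complex.sub_im, hb] at h1 h2
    linarith [(hmm u (by linarith)).2]
  have nua : ∀ t, ¬((F (t, a + L)).re = 0 ∧ 0 < (F (t, a + L)).im) := by
    rintro u ⟨h1, h2⟩
    simp only [hF, Complex.sub_re, Complex.sub_im, hper, ha] at h1 h2
    linarith [(hmm u (by linarith)).1]
  have npos : ∀ p, 0 < (F p).re → ¬((F p).re = 0 ∧ (F p).im < 0) := by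
    rintro p h ⟨h1, -⟩; linarith
  have him : (w a).im < (w b).im := by
    refine lt_of_le_of_ne (hmm b hb).1 (fun h => hinj a b hab hba ?_)
    exact Complex.ext (by rw [ha, hb]) h
  set m := ⌊ψ (a, b) + 1/4⌋ with hm
  set m' := ⌊ψ (b, a + L) - 1/4⌋ with hm'
  have v1 : ψ (a, b) = m + 1/4 := hupval _ (hmemD _ _ hab hba)
    (by simp [hF, ha, hb]) (by simp only [hF, Complex.sub_im]; linarith)
  have v2 : ψ (b, a + L) = m' + 3/4 := hdownval _ (hmemD _ _ hba (by linarith))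
    (by simp [hF, ha, hb, hper]) (by simp only [hF, Complex.sub_im, hper]; linarith)
  -- crossing near a point
  have cross_near : ∀ c, (w c).re = 0 → (∀ t, c - η ≤ t → t < c → (w t).re < 0) →
      (∀ t, c < t → t ≤ c + η → 0 < (w t).re) →
      ⌊ψ (c - η, c) + 1/4⌋ = ⌊ψ (c, c + η) + 1/4⌋ := by
    intro c hc hc1 hc2
    rw [vd (c - η) c (c + η), hd (c + η) (c - η) c]
    · intro t ht
      rw [Set.uIcc_of_le (by linarith)] at ht
      refine ⟨hmemD _ _ (by linarith [ht.2]) (by linarith [ht.1]), npos _ ?_⟩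
      simp only [hF, Complex.sub_re]
      have h1 := hc2 (c + η) (by linarith) le_rfl
      rcases ht.2.eq_or_lt with h | h
      · rw [h, hc]; linarith
      · linarith [hc1 t ht.1 h]
    · intro u hu
      rw [Set.uIcc_of_le (by linarith)] at hu
      refine ⟨hmemD _ _ (by linarith [hu.1]) (by linarith [hu.2]), npos _ ?_⟩
      simp only [hF, Complex.sub_re]
      have h1 := hc1 (c - η) le_rfl (by linarith)
      rcases hu.1.eq_or_lt with h | h
      · rw [← h, hc]; linarith
      · linarith [hc2 u h hu.2]
  have s1 : ⌊ψ (b - η, b) + 1/4⌋ = m := by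
    refine hd b _ _ (fun t ht => ⟨?_, ndb t⟩)
    obtain ⟨h1, h2⟩ := mem_seg (l := b - L) (r := b) ht (by linarith) (by linarith) (by linarith) (by linarith)
    exact hmemD _ _ h2 (by linarith)
  have s2 : ⌊ψ (b, b + η) + 1/4⌋ = m := by rw [← cross_near b hb hb1 hb2, s1]
  have s3 : ⌊ψ (b, b + η) - 1/4⌋ = m - 1 := by
    rw [hpos _ (hmemD _ _ (by linarith) (by linarith)), s2]
    simp only [hF, Complex.sub_re, hb]
    linarith [hb2 (b + η) (by linarith) le_rfl]
  have s4 : ⌊ψ (b, b + η) - 1/4⌋ = m' := by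
    refine vu b _ _ (fun u hu => ⟨?_, nub u⟩)
    obtain ⟨h1, h2⟩ := mem_seg (l := b) (r := b + L) hu (by linarith) (by linarith) (by linarith) (by linarith)
    exact hmemD _ _ h1 h2
  have hmm' : m' = m - 1 := by rw [← s4, s3]
  have hk1 : k = -1 := by
    have := hk (a, b) (hmemD _ _ hab hba)
    simp only at this
    rw [v1, v2, hmm'] at this
    push_cast at this
    have h : (k : ℝ) = -1 := by linarith
    exact_mod_cast h
  have s5 : ⌊ψ (a, a + η) + 1/4⌋ = m := by
    refine vd a _ _ (fun u hu => ⟨?_, nda u⟩)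
    obtain ⟨h1, h2⟩ := mem_seg (l := a) (r := a + L) hu (by linarith) (by linarith) (by linarith) (by linarith)
    exact hmemD _ _ h1 h2
  have s6 : ⌊ψ (a - η, a) + 1/4⌋ = m := by rw [cross_near a ha ha1 ha2, s5]
  have s7 : ⌊ψ (a - η, a) - 1/4⌋ = m - 1 := by
    rw [hpos _ (hmemD _ _ (by linarith) (by linarith)), s6]
    simp only [hF, Complex.sub_re, ha]
    linarith [ha1 (a - η) le_rfl (by linarith)]
  have s8 : ⌊ψ (a - η + L, a + L) - 1/4⌋ = m' := by
    refine hu (a + L) _ _ (fun t ht => ⟨?_, nua t⟩)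
    obtain ⟨h1, h2⟩ := mem_seg (l := a) (r := a + L) ht (by linarith) (by linarith) (by linarith) (by linarith)
    exact hmemD _ _ h2 (by linarith)
  have s9 : ψ (a - η + L, a + L) = ψ (a - η, a) - 1 := by
    have h1 := hk (a - η, a) (hmemD _ _ (by linarith) (by linarith))
    have h2 := hk (a, a - η + L) (hmemD _ _ (by linarith) (by linarith))
    simp only at h1 h2
    rw [h2, h1, hk1]; push_cast; ring
  rw [s9, show ψ (a - η, a) - 1 - 1/4 = ψ (a - η, a) - 1/4 - 1 by ring, Int.floor_sub_one, s7] at s8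
  omega

lemma parseval_aux (e₁ e₂ q : E3) (h1 : ‖e₁‖ = 1) (h2 : ‖e₂‖ = 1) (h3 : ‖q‖ = 1)
    (h12 : ⟪e₁, e₂⟫ = 0) (h13 : ⟪e₁, q⟫ = 0) (h23 : ⟪e₂, q⟫ = 0) (x : E3) :
    ⟪x, e₁⟫ ^ 2 + ⟪x, e₂⟫ ^ 2 + ⟪x, q⟫ ^ 2 = ‖x‖ ^ 2 := by
  have ho : Orthonormal ℝ ![e₁, e₂, q] := by
    constructor
    · intro i; fin_cases i <;> simp [h1, h2, h3]
    · intro i j hij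
      have h12' : ⟪e₂, e₁⟫ = 0 := by rw [real_inner_comm]; exact h12
      have h13' : ⟪q, e₁⟫ = 0 := by rw [real_inner_comm]; exact h13
      have h23' : ⟪q, e₂⟫ = 0 := by rw [real_inner_comm]; exact h23
      fin_cases i <;> fin_cases j <;> simp_all
  let B := basisOfOrthonormalOfCardEqFinrank ho (by simp)
  have hB : ⇑B = ![e₁, e₂, q] := coe_basisOfOrthonormalOfCardEqFinrank ho (by simp)
  let O := B.toOrthonormalBasis (by rw [hB]; exact ho)
  have hO : ⇑O = ![e₁, e₂, q] := by rw [Module.Basis.coe_toOrthonormalBasis, hB]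
  have := O.sum_sq_norm_inner_left x
  rw [hO, Fin.sum_univ_three] at this
  simpa using this

lemma sphere_frame_aux (γ : ℝ → E3) (L : ℝ) (hγ : Continuous γ) (hper : ∀ t, γ (t + L) = γ t)
    (hinj : ∀ t u, t < u → u < t + L → γ t ≠ γ u) (hunit : ∀ t, ‖γ t‖ = 1)
    (e₁ e₂ q : E3) (h1 : ‖e₁‖ = 1) (h2 : ‖e₂‖ = 1) (h3 : ‖q‖ = 1)
    (h12 : ⟪e₁, e₂⟫ = 0) (h13 : ⟪e₁, q⟫ = 0) (h23 : ⟪e₂, q⟫ = 0)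
    (κ μ : ℝ) (hκ : 0 < κ) (hμ : 0 < μ) (hκμ : κ ^ 2 + μ ^ 2 = 1)
    (a b : ℝ) (hab : a < b) (hba : b < a + L)
    (hga : γ a = κ • q - μ • e₂) (hgb : γ b = κ • q + μ • e₂)
    (hq : ∀ t, ⟪γ t, e₁⟫ = 0 → ⟪γ t, q⟫ ≤ κ)
    (η : ℝ) (hη : 0 < η) (hηL : 2 * η < L)
    (ha1 : ∀ t, a - η ≤ t → t < a → ⟪γ t, e₁⟫ < 0) (ha2 : ∀ t, a < t → t ≤ a + η → 0 < ⟪γ t, e₁⟫)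
    (hb1 : ∀ t, b - η ≤ t → t < b → ⟪γ t, e₁⟫ < 0) (hb2 : ∀ t, b < t → t ≤ b + η → 0 < ⟪γ t, e₁⟫) :
    False := by
  have hκ1 : κ < 1 := by nlinarith
  have pars := parseval_aux e₁ e₂ q h1 h2 h3 h12 h13 h23
  have par1 : ∀ t, ⟪γ t, e₁⟫ ^ 2 + ⟪γ t, e₂⟫ ^ 2 + ⟪γ t, q⟫ ^ 2 = 1 := by
    intro t; rw [pars, hunit]; norm_num
  have h12' : ⟪e₂, e₁⟫ = 0 := by rw [real_inner_comm]; exact h12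
  have h13' : ⟪q, e₁⟫ = 0 := by rw [real_inner_comm]; exact h13
  have h23' : ⟪q, e₂⟫ = 0 := by rw [real_inner_comm]; exact h23
  have A1 : ⟪γ a, e₁⟫ = 0 := by simp [hga, inner_sub_left, real_inner_smul_left, h13', h12']
  have B1 : ⟪γ b, e₁⟫ = 0 := by simp [hgb, inner_add_left, real_inner_smul_left, h13', h12']
  have A2 : ⟪γ a, e₂⟫ = -μ := by simp [hga, inner_sub_left, real_inner_smul_left, h23', h2]
  have B2 : ⟪γ b, e₂⟫ = μ := by simp [hgb, inner_add_left, real_inner_smul_left, h23', h2]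
  have A3 : ⟪γ a, q⟫ = κ := by simp [hga, inner_sub_left, real_inner_smul_left, h23, h3]
  have B3 : ⟪γ b, q⟫ = κ := by simp [hgb, inner_add_left, real_inner_smul_left, h23, h3]
  have hlt : ∀ t, ⟪γ t, q⟫ < 1 := by
    intro t
    by_contra hc
    push Not at hc
    have := par1 t
    have h0 : ⟪γ t, e₁⟫ = 0 := by
      have : ⟪γ t, e₁⟫ ^ 2 = 0 := by nlinarith [sq_nonneg ⟪γ t, e₁⟫, sq_nonneg ⟪γ t, e₂⟫]
      exact pow_eq_zero_iff (two_ne_zero) |>.1 this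
    linarith [hq t h0]
  set w : ℝ → ℂ := fun t => ⟨⟪γ t, e₁⟫ / (1 - ⟪γ t, q⟫), ⟪γ t, e₂⟫ / (1 - ⟪γ t, q⟫)⟩ with hw
  have hpos : ∀ t, 0 < 1 - ⟪γ t, q⟫ := fun t => by linarith [hlt t]
  have hre : ∀ t, (w t).re = ⟪γ t, e₁⟫ / (1 - ⟪γ t, q⟫) := fun t => rfl
  have him : ∀ t, (w t).im = ⟪γ t, e₂⟫ / (1 - ⟪γ t, q⟫) := fun t => rfl
  have hre0 : ∀ t, (w t).re = 0 → ⟪γ t, e₁⟫ = 0 := by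
    intro t h
    rw [hre] at h
    exact (div_eq_zero_iff.1 h).resolve_right (hpos t).ne'
  refine planar_aux w L ?_ ?_ ?_ a b hab hba ?_ ?_ ?_ η hη hηL ?_ ?_ ?_ ?_
  · have : w = fun t => (((⟪γ t, e₁⟫ / (1 - ⟪γ t, q⟫) : ℝ)) : ℂ) +
        ((⟪γ t, e₂⟫ / (1 - ⟪γ t, q⟫) : ℝ) : ℂ) * Complex.I := by
      ext t
      exact Complex.mk_eq_add_mul_I _ _
    rw [this]
    have c1 : Continuous fun t => ⟪γ t, e₁⟫ / (1 - ⟪γ t, q⟫) :=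
      Continuous.div (by fun_prop) (by fun_prop) (fun t => (hpos t).ne')
    have c2 : Continuous fun t => ⟪γ t, e₂⟫ / (1 - ⟪γ t, q⟫) :=
      Continuous.div (by fun_prop) (by fun_prop) (fun t => (hpos t).ne')
    exact (Complex.continuous_ofReal.comp c1).add
      ((Complex.continuous_ofReal.comp c2).mul continuous_const)
  · intro t; simp only [hw, hper]
  · intro t u htu hut heq
    apply hinj t u htu hut
    have r := congrArg Complex.re heq
    have i := congrArg Complex.im heq
    rw [hre, hre] at r
    rw [him, him] at i
    have pt := par1 t
    have pu := par1 u
    have ht := hpos t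
    have hu := hpos u
    set X := ⟪γ t, e₁⟫; set Y := ⟪γ t, e₂⟫; set Z := ⟪γ t, q⟫
    set X' := ⟪γ u, e₁⟫; set Y' := ⟪γ u, e₂⟫; set Z' := ⟪γ u, q⟫
    have hs : (X / (1 - Z)) ^ 2 + (Y / (1 - Z)) ^ 2 = (1 + Z) / (1 - Z) := by
      field_simp
      linarith
    have hs' : (X' / (1 - Z')) ^ 2 + (Y' / (1 - Z')) ^ 2 = (1 + Z') / (1 - Z') := by
      field_simp
      linarith
    rw [r, i, hs', div_eq_div_iff hu.ne' ht.ne'] at hs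
    have hZ : Z = Z' := by linarith
    rw [hZ] at r i
    have hX : X = X' := by
      have := (div_left_inj' hu.ne').1 r; exact this
    have hY : Y = Y' := by
      have := (div_left_inj' hu.ne').1 i; exact this
    have := pars (γ t - γ u)
    rw [inner_sub_left, inner_sub_left, inner_sub_left] at this
    change (X - X') ^ 2 + (Y - Y') ^ 2 + (Z - Z') ^ 2 = _ at this
    rw [hX, hY, hZ] at this
    have h0 : ‖γ t - γ u‖ ^ 2 = 0 := by rw [← this]; ring
    exact sub_eq_zero.1 (norm_eq_zero.1 (pow_eq_zero_iff (two_ne_zero) |>.1 h0))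
  · rw [hre, A1]; simp
  · rw [hre, B1]; simp
  · intro t ht
    have h0 := hre0 t ht
    have hY := hq t h0
    have hp := par1 t
    have ht := hpos t
    rw [him, him, him, A2, B2, A3, B3]
    rw [h0] at hp
    set X := ⟪γ t, e₂⟫; set Y := ⟪γ t, q⟫
    have hk : 0 < 1 - κ := by linarith
    have hsq : (X * (1 - κ)) ^ 2 ≤ (μ * (1 - Y)) ^ 2 := by
      have e : (μ * (1 - Y)) ^ 2 - (X * (1 - κ)) ^ 2 = 2 * (1 - κ) * (1 - Y) * (κ - Y) := by
        have hX : X ^ 2 = 1 - Y ^ 2 := by linarith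
        have hm : μ ^ 2 = 1 - κ ^ 2 := by linarith
        rw [mul_pow, mul_pow, hX, hm]; ring
      have : 0 ≤ 2 * (1 - κ) * (1 - Y) * (κ - Y) := by
        have : 0 ≤ κ - Y := by linarith
        positivity
      linarith
    have habs := abs_le_of_sq_le_sq hsq (by positivity)
    obtain ⟨l, r⟩ := abs_le.1 habs
    constructor
    · rw [div_le_div_iff₀ hk ht]; linarith
    · rw [div_le_div_iff₀ ht hk]; linarith
  · intro t l r; rw [hre]; exact div_neg_of_neg_of_pos (ha1 t l r) (hpos t)
  · intro t l r; rw [hre]; exact div_pos (ha2 t l r) (hpos t)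
  · intro t l r; rw [hre]; exact div_neg_of_neg_of_pos (hb1 t l r) (hpos t)
  · intro t l r; rw [hre]; exact div_pos (hb2 t l r) (hpos t)

lemma sphere_aux (γ : ℝ → E3) (L : ℝ) (hγ : Continuous γ) (hper : ∀ t, γ (t + L) = γ t)
    (hinj : ∀ t u, t < u → u < t + L → γ t ≠ γ u) (hunit : ∀ t, ‖γ t‖ = 1)
    (e₁ : E3) (h1 : ‖e₁‖ = 1)
    (a b : ℝ) (hab : a < b) (hba : b < a + L)
    (hga : ⟪γ a, e₁⟫ = 0) (hgb : ⟪γ b, e₁⟫ = 0) (hneg : -1 < ⟪γ b, γ a⟫)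
    (hq : ∀ t, ⟪γ t, e₁⟫ = 0 → γ t = γ a ∨ ⟪γ t, γ a⟫ ≤ ⟪γ b, γ a⟫)
    (η : ℝ) (hη : 0 < η) (hηL : 2 * η < L)
    (ha1 : ∀ t, a - η ≤ t → t < a → ⟪γ t, e₁⟫ < 0) (ha2 : ∀ t, a < t → t ≤ a + η → 0 < ⟪γ t, e₁⟫)
    (hb1 : ∀ t, b - η ≤ t → t < b → ⟪γ t, e₁⟫ < 0) (hb2 : ∀ t, b < t → t ≤ b + η → 0 < ⟪γ t, e₁⟫) :
    False := by
  set p := γ a with hp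
  set x := γ b with hx
  set c := ⟪x, p⟫ with hc
  have hpp : ⟪p, p⟫ = 1 := by rw [real_inner_self_eq_norm_sq, hunit]; norm_num
  have hxx : ⟪x, x⟫ = 1 := by rw [real_inner_self_eq_norm_sq, hunit]; norm_num
  have hpx : ⟪p, x⟫ = c := by rw [real_inner_comm]
  have hn1 : ‖p + x‖ ^ 2 = 2 + 2 * c := by
    rw [← real_inner_self_eq_norm_sq, inner_add_left, inner_add_right, inner_add_right, hpp, hxx, hpx]; ring
  have hn2 : ‖x - p‖ ^ 2 = 2 - 2 * c := by
    rw [← real_inner_self_eq_norm_sq, inner_sub_left, inner_sub_right, inner_sub_right, hpp, hxx, hpx]; ring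
  set κ := ‖p + x‖ / 2 with hκ
  set μ := ‖x - p‖ / 2 with hμ
  have hne : x - p ≠ 0 := sub_ne_zero.2 (hinj a b hab hba).symm
  have hμ0 : 0 < μ := by have := norm_pos_iff.2 hne; positivity
  have hκ0 : 0 < κ := by
    have : 0 < ‖p + x‖ := by
      have := norm_nonneg (p + x)
      rcases this.eq_or_lt with h | h
      · rw [← h] at hn1; linarith
      · exact h
    positivity
  have hk2 : κ ^ 2 = (1 + c) / 2 := by rw [hκ, div_pow, hn1]; ring
  have hm2 : μ ^ 2 = (1 - c) / 2 := by rw [hμ, div_pow, hn2]; ring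
  set q := (1 / (2 * κ)) • (p + x) with hqd
  set e₂ := (1 / (2 * μ)) • (x - p) with hed
  have hqn : ‖q‖ = 1 := by
    rw [hqd, norm_smul, Real.norm_of_nonneg (by positivity), show ‖p + x‖ = 2 * κ by rw [hκ]; ring]
    field_simp
  have hen : ‖e₂‖ = 1 := by
    rw [hed, norm_smul, Real.norm_of_nonneg (by positivity), show ‖x - p‖ = 2 * μ by rw [hμ]; ring]
    field_simp
  have hga' : ⟪e₁, p⟫ = 0 := by rw [real_inner_comm]; exact hga
  have hgb' : ⟪e₁, x⟫ = 0 := by rw [real_inner_comm]; exact hgb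
  have h12 : ⟪e₁, e₂⟫ = 0 := by simp [hed, inner_smul_right, inner_sub_right, hga', hgb']
  have h13 : ⟪e₁, q⟫ = 0 := by simp [hqd, inner_smul_right, inner_add_right, hga', hgb']
  have h23 : ⟪e₂, q⟫ = 0 := by
    rw [hed, hqd, inner_smul_right, real_inner_smul_left, inner_sub_left, inner_add_right,
      inner_add_right, hpp, hxx, hpx]
    simp only [← hc]; ring
  have hpe : p = κ • q - μ • e₂ := by
    rw [hqd, hed, smul_smul, smul_smul, show κ * (1 / (2 * κ)) = 1/2 by field_simp,
      show μ * (1 / (2 * μ)) = 1/2 by field_simp]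
    module
  have hxe : x = κ • q + μ • e₂ := by
    rw [hqd, hed, smul_smul, smul_smul, show κ * (1 / (2 * κ)) = 1/2 by field_simp,
      show μ * (1 / (2 * μ)) = 1/2 by field_simp]
    module
  clear_value q e₂
  refine sphere_frame_aux γ L hγ hper hinj hunit e₁ e₂ q h1 hen hqn h12 h13 h23 κ μ hκ0 hμ0
    (by rw [hk2, hm2]; ring) a b hab hba hpe hxe ?_ η hη hηL ha1 ha2 hb1 hb2
  intro t ht
  have hqq : ⟪q, q⟫ = 1 := by rw [real_inner_self_eq_norm_sq, hqn]; norm_num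
  rcases hq t ht with h | h
  · rw [h, hpe, inner_sub_left, real_inner_smul_left, real_inner_smul_left, hqq, h23]
    simp
  · have par := parseval_aux e₁ e₂ q h1 hen hqn h12 h13 h23 (γ t)
    rw [ht, hunit] at par
    have e : ⟪γ t, p⟫ = κ * ⟪γ t, q⟫ - μ * ⟪γ t, e₂⟫ := by
      rw [hpe, inner_sub_right, inner_smul_right, inner_smul_right]
    rw [e] at h
    by_contra hcon
    push Not at hcon
    set Y := ⟪γ t, q⟫
    set X := ⟪γ t, e₂⟫
    have hX : X < μ := by
      have : X ^ 2 < μ ^ 2 := by nlinarith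
      exact lt_of_pow_lt_pow_left₀ 2 hμ0.le this
    nlinarith [mul_pos hκ0 (sub_pos.2 hcon), mul_pos hμ0 (sub_pos.2 hX)]

lemma phi_bound_aux (φ : ℝ → ℝ) (hc : Continuous φ) (h0 : ∀ h, 0 ≤ φ h)
    (hs1 : ∀ h k, φ (h + k) ≤ 2 * φ h + 2 * φ k) (hs2 : ∀ h k, φ h ≤ 2 * φ (h + k) + 2 * φ k)
    (s B : ℝ) (hs : s ∈ Set.Ioo (1/2 : ℝ) 1) (hB : 0 < B)
    (hE : ∫⁻ h in Set.Ioc (0:ℝ) 1, ENNReal.ofReal (φ h * h ^ (-2 - s)) ≤ ENNReal.ofReal (B / (1 - s))) :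
    ∀ h, 0 < h → h ≤ 1/4 → φ h ≤ 80 * B * h ^ (3/2 : ℝ) := by
  obtain ⟨hs0, hs1'⟩ := hs
  have hs3 : 0 < 1 - s := by linarith
  set g : ℝ → ℝ := fun h => φ h * h ^ (-2 - s) with hg
  have hg0 : ∀ h, 0 ≤ h → 0 ≤ g h := fun h hh => mul_nonneg (h0 h) (Real.rpow_nonneg hh _)
  have hgm : Measurable g := hc.measurable.mul (measurable_id.pow_const _)
  have hint : IntegrableOn g (Set.Ioc 0 1) := by
    refine (lintegral_ofReal_ne_top_iff_integrable hgm.aestronglyMeasurable ?_).1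
      (ne_top_of_le_ne_top ENNReal.ofReal_ne_top hE)
    exact (ae_restrict_iff' measurableSet_Ioc).2 (Filter.Eventually.of_forall fun h hh => hg0 h hh.1.le)
  have hii : ∀ a b, 0 ≤ a → a ≤ b → b ≤ 1 → IntervalIntegrable g volume a b := by
    intro a b ha hab hb
    rw [intervalIntegrable_iff_integrableOn_Ioc_of_le hab]
    exact hint.mono_set (Set.Ioc_subset_Ioc ha hb)
  have hE1 : ∫ h in (0:ℝ)..1, g h ≤ B / (1 - s) := by
    rw [intervalIntegral.integral_of_le zero_le_one]
    rw [← ENNReal.ofReal_le_ofReal_iff (by positivity),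
      ofReal_integral_eq_lintegral_ofReal hint]
    · exact hE
    · exact (ae_restrict_iff' measurableSet_Ioc).2 (Filter.Eventually.of_forall fun h hh => hg0 h hh.1.le)
  have hEρ : ∀ ρ, 0 < ρ → ρ ≤ 1 → ∫ h in (0:ℝ)..ρ, g h ≤ B / (1 - s) := by
    intro ρ h1 h2
    refine le_trans ?_ hE1
    rw [← intervalIntegral.integral_add_adjacent_intervals (hii 0 ρ le_rfl h1.le h2) (hii ρ 1 h1.le h2 le_rfl)]
    have : 0 ≤ ∫ h in ρ..1, g h :=
      intervalIntegral.integral_nonneg h2 (fun u hu => hg0 u (h1.le.trans hu.1))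
    linarith
  have hhalf : ∀ ρ, 0 < ρ → ρ ≤ 1 →
      ∫ h in (0:ℝ)..ρ, g h ≤ 2 ^ (1 - s) * ∫ h in (0:ℝ)..(ρ/2), g h := by
    intro ρ h1 h2
    have e1 : ∫ h in (0:ℝ)..ρ, g (h / 2) = 2 * ∫ h in (0:ℝ)..(ρ/2), g h := by
      rw [intervalIntegral.integral_comp_div (fun x => g x) (two_ne_zero)]; simp
    have hi2 : IntervalIntegrable (fun h => g (h / 2)) volume 0 ρ := by
      have := IntervalIntegrable.comp_mul_left (hii 0 (ρ/2) le_rfl (by linarith) (by linarith)) (c := 1/2)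
      rw [show (0:ℝ) / (1/2) = 0 by norm_num, show ρ / 2 / (1/2) = ρ by ring] at this
      refine this.congr ?_
      intro h _
      simp only []
      congr 1
      ring
    have e2 : ∫ h in (0:ℝ)..ρ, g h ≤ ∫ h in (0:ℝ)..ρ, 2 ^ (-s) * g (h / 2) := by
      refine intervalIntegral.integral_mono_on_of_le_Ioo h1.le (hii 0 ρ le_rfl h1.le h2)
        (hi2.const_mul _) ?_
      intro h hh
      have hpos := hh.1
      have p1 : φ h ≤ 4 * φ (h / 2) := by
        have := hs1 (h/2) (h/2)
        rw [add_halves] at this; linarith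
      have p2 : (h / 2) ^ (-2 - s) = h ^ (-2 - s) * (4 * 2 ^ s) := by
        rw [Real.div_rpow hpos.le (by norm_num), div_eq_mul_inv, ← Real.rpow_neg (by norm_num),
          show -(-2 - s) = 2 + s by ring, Real.rpow_add (by norm_num)]
        norm_num
      have p3 : (2:ℝ) ^ (-s) * 2 ^ s = 1 := by
        rw [← Real.rpow_add (by norm_num)]; simp
      simp only [hg, p2]
      have : (2:ℝ) ^ (-s) * (φ (h / 2) * (h ^ (-2 - s) * (4 * 2 ^ s))) =
        (4 * φ (h/2)) * h ^ (-2 - s) * (2 ^ (-s) * 2 ^ s) := by ring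
      rw [this, p3, mul_one]
      exact mul_le_mul_of_nonneg_right p1 (Real.rpow_nonneg hpos.le _)
    rw [intervalIntegral.integral_const_mul, e1] at e2
    refine e2.trans (le_of_eq ?_)
    rw [← mul_assoc, show (1 - s) = -s + 1 by ring, Real.rpow_add (by norm_num)]
    norm_num
  have he0 : ∀ ρ, 0 < ρ → ρ ≤ 1 → ∫ h in (ρ/2)..ρ, g h ≤ B := by
    intro ρ h1 h2
    have hadd := intervalIntegral.integral_add_adjacent_intervals
      (hii 0 (ρ/2) le_rfl (by linarith) (by linarith)) (hii (ρ/2) ρ (by linarith) (by linarith) h2)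
    have hh := hhalf ρ h1 h2
    have hEr := hEρ ρ h1 h2
    have hp : s * 2 ^ (1 - s) ≤ 1 := by
      have h3 : s ≤ 2 ^ (-(1 - s)) := by
        rw [Real.rpow_def_of_pos (by norm_num)]
        have h4 := Real.add_one_le_exp (Real.log 2 * -(1 - s))
        have h5 : Real.log 2 ≤ 1 := by linarith [Real.log_two_lt_d9]
        nlinarith
      have h6 : (2:ℝ) ^ (-(1 - s)) * 2 ^ (1 - s) = 1 := by
        rw [← Real.rpow_add (by norm_num)]; simp
      have h7 : (0:ℝ) < 2 ^ (1 - s) := Real.rpow_pos_of_pos (by norm_num) _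
      nlinarith
    set I1 := ∫ h in (0:ℝ)..(ρ/2), g h
    set I := ∫ h in (0:ℝ)..ρ, g h
    have hI1 : 0 ≤ I1 := intervalIntegral.integral_nonneg (by linarith) (fun u hu => hg0 u hu.1)
    have : s * I ≤ I1 := by
      calc s * I ≤ s * (2 ^ (1 - s) * I1) := mul_le_mul_of_nonneg_left hh (by linarith)
        _ = (s * 2 ^ (1 - s)) * I1 := by ring
        _ ≤ 1 * I1 := mul_le_mul_of_nonneg_right hp hI1
        _ = I1 := one_mul _
    have h8 : (1 - s) * I ≤ B := by
      rw [le_div_iff₀ hs3] at hEr; linarith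
    linarith
  have hann : ∀ ρ, 0 < ρ → ρ ≤ 1 → ∫ h in (ρ/2)..ρ, φ h ≤ B * ρ ^ (5/2 : ℝ) := by
    intro ρ h1 h2
    have e : ∫ h in (ρ/2)..ρ, φ h ≤ ∫ h in (ρ/2)..ρ, ρ ^ (2 + s) * g h := by
      refine intervalIntegral.integral_mono_on (by linarith) (hc.intervalIntegrable _ _)
        ((hii (ρ/2) ρ (by linarith) (by linarith) h2).const_mul _) ?_
      intro h hh
      have hpos : 0 < h := by linarith [hh.1]
      have p1 : 1 ≤ ρ ^ (2 + s) * h ^ (-2 - s) := by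
        rw [show (-2 - s) = -(2 + s) by ring, Real.rpow_neg hpos.le, ← div_eq_mul_inv,
          one_le_div (Real.rpow_pos_of_pos hpos _)]
        exact Real.rpow_le_rpow hpos.le hh.2 (by linarith)
      simp only [hg]
      nlinarith [mul_le_mul_of_nonneg_left p1 (h0 h)]
    rw [intervalIntegral.integral_const_mul] at e
    have p2 : ρ ^ (2 + s) ≤ ρ ^ (5/2 : ℝ) :=
      Real.rpow_le_rpow_of_exponent_ge h1 h2 (by linarith)
    calc _ ≤ _ := e
      _ ≤ ρ ^ (2 + s) * B := mul_le_mul_of_nonneg_left (he0 ρ h1 h2) (Real.rpow_nonneg h1.le _)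
      _ ≤ ρ ^ (5/2 : ℝ) * B := mul_le_mul_of_nonneg_right p2 hB.le
      _ = _ := mul_comm _ _
  intro h hh hh4
  have i1 := hann (2 * h) (by linarith) (by linarith)
  have i2 := hann (4 * h) (by linarith) (by linarith)
  rw [show 2 * h / 2 = h by ring] at i1
  rw [show 4 * h / 2 = 2 * h by ring] at i2
  have p4 : (4 * h) ^ (5/2 : ℝ) = 32 * h ^ (5/2 : ℝ) := by
    rw [Real.mul_rpow (by norm_num) hh.le, show (4:ℝ) = 2 ^ (2:ℝ) by norm_num, ← Real.rpow_mul (by norm_num)]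
    norm_num
  have p2 : (2 * h) ^ (5/2 : ℝ) ≤ 8 * h ^ (5/2 : ℝ) := by
    rw [Real.mul_rpow (by norm_num) hh.le]
    have : (2:ℝ) ^ (5/2 : ℝ) ≤ 2 ^ (3 : ℝ) := Real.rpow_le_rpow_of_exponent_le (by norm_num) (by norm_num)
    norm_num at this
    exact mul_le_mul_of_nonneg_right this (Real.rpow_nonneg hh.le _)
  have i3 : ∫ k in h..(2*h), φ h ≤ ∫ k in h..(2*h), (2 * φ (h + k) + 2 * φ k) := by
    refine intervalIntegral.integral_mono_on (by linarith) (by simp)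
      (Continuous.intervalIntegrable (by fun_prop) _ _) (fun k _ => hs2 h k)
  rw [intervalIntegral.integral_const, intervalIntegral.integral_add
    (Continuous.intervalIntegrable (by fun_prop) _ _) (Continuous.intervalIntegrable (by fun_prop) _ _),
    intervalIntegral.integral_const_mul, intervalIntegral.integral_const_mul,
    intervalIntegral.integral_comp_add_left (fun x => φ x)] at i3
  have i4 : ∫ x in (h + h)..(h + 2 * h), φ x ≤ ∫ x in (2 * h)..(4 * h), φ x := by
    rw [show h + h = 2 * h by ring]
    rw [← intervalIntegral.integral_add_adjacent_intervals (b := h + 2 * h) (hc.intervalIntegrable (2*h) (h + 2 * h))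
      (hc.intervalIntegrable (h + 2 * h) (4 * h))]
    have : 0 ≤ ∫ x in (h + 2 * h)..(4 * h), φ x :=
      intervalIntegral.integral_nonneg (by linarith) (fun u _ => h0 u)
    linarith
  rw [smul_eq_mul, show 2 * h - h = h by ring] at i3
  rw [p4] at i2
  have p5 : h ^ (5/2 : ℝ) = h * h ^ (3/2 : ℝ) := by
    rw [show (5/2 : ℝ) = 1 + 3/2 by norm_num, Real.rpow_add hh, Real.rpow_one]
  have : h * φ h ≤ h * (80 * B * h ^ (3/2 : ℝ)) := by
    have := mul_le_mul_of_nonneg_left p2 hB.le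
    rw [p5] at i2 this
    linarith
  exact le_of_mul_le_mul_left this hh

lemma telescope_aux (f : ℝ → E3) (hf : Continuous f) (L : ℝ) (hL : 1 ≤ L)
    (hper : ∀ t, f (t + L) = f t) (A : ℝ) (hA : 0 < A)
    (hφ : ∀ h, 0 < h → h ≤ 1/4 → ∫ t in (0:ℝ)..L, ‖f (t + h) - f t‖ ^ 2 ≤ A ^ 2 * h ^ (3/2 : ℝ)) :
    ∀ x ρ, 0 < ρ → ρ ≤ 1/4 → ‖f (x + ρ) - f x‖ ≤ 9 * A * ρ ^ (1/4 : ℝ) := by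
  have hJ : ∀ x ρ, 0 < ρ → ρ ≤ 1/4 →
      ‖∫ τ in (0:ℝ)..ρ, (f (x + τ + ρ) - f (x + τ))‖ ≤ ρ * (A * ρ ^ (1/4 : ℝ)) := by
    intro x ρ h1 h2
    set ε := A * ρ ^ (1/4 : ℝ) with hε
    have hε0 : 0 < ε := mul_pos hA (Real.rpow_pos_of_pos h1 _)
    have a1 : ‖∫ τ in (0:ℝ)..ρ, (f (x + τ + ρ) - f (x + τ))‖ ≤
        ∫ τ in (0:ℝ)..ρ, (ε / 2 + (1 / (2 * ε)) * ‖f (x + τ + ρ) - f (x + τ)‖ ^ 2) := by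
      refine (intervalIntegral.norm_integral_le_integral_norm h1.le).trans ?_
      refine intervalIntegral.integral_mono_on h1.le (Continuous.intervalIntegrable (by fun_prop) _ _)
        (Continuous.intervalIntegrable (by fun_prop) _ _) ?_
      intro τ _
      set v := ‖f (x + τ + ρ) - f (x + τ)‖
      have : ε / 2 + 1 / (2 * ε) * v ^ 2 - v = (1 / (2 * ε)) * (ε - v) ^ 2 := by
        field_simp; ring
      have h3 : 0 ≤ (1 / (2 * ε)) * (ε - v) ^ 2 := by positivity
      linarith
    have a2 : ∫ τ in (0:ℝ)..ρ, ‖f (x + τ + ρ) - f (x + τ)‖ ^ 2 ≤ A ^ 2 * ρ ^ (3/2 : ℝ) := by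
      refine le_trans ?_ (hφ ρ h1 h2)
      have e1 := intervalIntegral.integral_comp_add_left (a := 0) (b := ρ) (fun t => ‖f (t + ρ) - f t‖ ^ 2) x
      rw [e1]
      have hp : Function.Periodic (fun t => ‖f (t + ρ) - f t‖ ^ 2) L := by
        intro t
        simp only [hper, show t + L + ρ = t + ρ + L by ring]
      have e2 := hp.intervalIntegral_add_eq x 0
      rw [zero_add] at e2
      rw [← e2, add_zero]
      have hc : Continuous (fun t => ‖f (t + ρ) - f t‖ ^ 2) := by fun_prop
      rw [← intervalIntegral.integral_add_adjacent_intervals (b := x + ρ) (hc.intervalIntegrable x (x + ρ))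
        (hc.intervalIntegrable (x + ρ) (x + L))]
      have : 0 ≤ ∫ t in (x + ρ)..(x + L), ‖f (t + ρ) - f t‖ ^ 2 :=
        intervalIntegral.integral_nonneg (by linarith) (fun u _ => by positivity)
      linarith
    rw [intervalIntegral.integral_add (Continuous.intervalIntegrable (by fun_prop) _ _)
      (Continuous.intervalIntegrable (by fun_prop) _ _), intervalIntegral.integral_const,
      intervalIntegral.integral_const_mul] at a1
    have a3 : A ^ 2 * ρ ^ (3/2 : ℝ) = ρ * ε ^ 2 := by
      rw [hε, mul_pow, ← Real.rpow_natCast (ρ ^ (1/4:ℝ)), ← Real.rpow_mul h1.le,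
        show (3/2 : ℝ) = 1 + 1/4 * ((2:ℕ):ℝ) by norm_num, Real.rpow_add h1, Real.rpow_one]
      ring
    rw [a3] at a2
    have a4 : 1 / (2 * ε) * ∫ τ in (0:ℝ)..ρ, ‖f (x + τ + ρ) - f (x + τ)‖ ^ 2 ≤ 1 / (2 * ε) * (ρ * ε ^ 2) :=
      mul_le_mul_of_nonneg_left a2 (by positivity)
    have a5 : 1 / (2 * ε) * (ρ * ε ^ 2) = ρ * ε / 2 := by field_simp
    rw [smul_eq_mul] at a1
    linarith
  set M : ℝ → ℝ → E3 := fun x ρ => ρ⁻¹ • ∫ τ in (0:ℝ)..ρ, f (x + τ) with hM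
  have hstep : ∀ x ρ, 0 < ρ → ρ ≤ 1/4 → ‖M x ρ - M x (ρ/2)‖ ≤ A / 2 * (ρ/2) ^ (1/4 : ℝ) := by
    intro x ρ h1 h2
    have e : M x ρ - M x (ρ/2) = ρ⁻¹ • ∫ τ in (0:ℝ)..(ρ/2), (f (x + τ + ρ/2) - f (x + τ)) := by
      have c1 : Continuous fun τ => f (x + τ) := by fun_prop
      have c2 : Continuous fun τ => f (x + τ + ρ/2) := by fun_prop
      rw [intervalIntegral.integral_sub (c2.intervalIntegrable _ _) (c1.intervalIntegrable _ _)]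
      have e1 := intervalIntegral.integral_comp_add_right (a := 0) (b := ρ/2) (fun τ => f (x + τ)) (ρ/2)
      simp only [zero_add, add_halves, ← add_assoc] at e1
      rw [e1]
      simp only [hM]
      rw [← intervalIntegral.integral_add_adjacent_intervals (b := ρ/2) (c1.intervalIntegrable 0 (ρ/2))
        (c1.intervalIntegrable (ρ/2) ρ), inv_div]
      rw [show (2 / ρ) = ρ⁻¹ * 2 by ring]
      module
    rw [e, norm_smul, norm_inv, Real.norm_of_nonneg h1.le]
    have := hJ x (ρ/2) (by linarith) (by linarith)
    calc ρ⁻¹ * _ ≤ ρ⁻¹ * (ρ/2 * (A * (ρ/2) ^ (1/4 : ℝ))) := mul_le_mul_of_nonneg_left this (by positivity)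
      _ = _ := by field_simp
  have hv : ∀ x ρ, 0 < ρ → ρ ≤ 1/4 → ‖f x - M x ρ‖ ≤ 4 * A * ρ ^ (1/4 : ℝ) := by
    intro x ρ h1 h2
    have hind : ∀ n : ℕ, ‖f x - M x ρ‖ - 4 * A * ρ ^ (1/4 : ℝ) ≤
        ‖f x - M x (ρ / 2 ^ n)‖ - 4 * A * (ρ / 2 ^ n) ^ (1/4 : ℝ) := by
      intro n
      induction n with
      | zero => simp
      | succ n ih =>
        refine ih.trans ?_
        set r := ρ / 2 ^ n with hr
        have hr0 : 0 < r := by positivity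
        have hr1 : r ≤ 1/4 := (div_le_self h1.le (one_le_pow₀ (by norm_num))).trans h2
        rw [show ρ / 2 ^ (n + 1) = r / 2 by rw [hr, pow_succ]; field_simp]
        have h3 := hstep x r hr0 hr1
        have h4 : ‖f x - M x r‖ ≤ ‖f x - M x (r/2)‖ + ‖M x r - M x (r/2)‖ := by
          have : f x - M x r = (f x - M x (r/2)) - (M x r - M x (r/2)) := by abel
          rw [this]; exact norm_sub_le _ _
        have h5 : 1.15 * (r/2) ^ (1/4 : ℝ) ≤ r ^ (1/4 : ℝ) := by
          have e : r ^ (1/4 : ℝ) = 2 ^ (1/4 : ℝ) * (r/2) ^ (1/4 : ℝ) := by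
            rw [← Real.mul_rpow (by norm_num) (by positivity)]; congr 1; ring
          rw [e]
          refine mul_le_mul_of_nonneg_right ?_ (by positivity)
          have e2 : (1.15:ℝ) = ((1.15:ℝ) ^ (4:ℝ)) ^ (1/4 : ℝ) := by
            rw [← Real.rpow_mul (by norm_num)]; norm_num
          rw [e2]
          refine Real.rpow_le_rpow (by positivity) ?_ (by norm_num)
          norm_num
        have h7 := mul_le_mul_of_nonneg_left h5 (by positivity : 0 ≤ 4 * A)
        have h8 : 0 ≤ A * (r/2) ^ (1/4 : ℝ) := by positivity
        nlinarith
    apply le_of_forall_pos_le_add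
    intro ε hε
    obtain ⟨δ, hδ, hδ'⟩ := Metric.continuous_iff.1 hf x ε hε
    obtain ⟨n, hn⟩ : ∃ n : ℕ, ρ / 2 ^ n < δ := by
      obtain ⟨n, hn⟩ := pow_unbounded_of_one_lt (ρ / δ) (one_lt_two)
      exact ⟨n, by rw [div_lt_iff₀ (by positivity)]; rw [div_lt_iff₀ hδ] at hn; linarith⟩
    have h3 := hind n
    set r := ρ / 2 ^ n with hr
    have hr0 : 0 < r := by positivity
    have h4 : ‖f x - M x r‖ ≤ ε := by
      have e : f x - M x r = r⁻¹ • ∫ τ in (0:ℝ)..r, (f x - f (x + τ)) := by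
        rw [intervalIntegral.integral_sub (by simp) (Continuous.intervalIntegrable (by fun_prop) _ _),
          intervalIntegral.integral_const, smul_sub, sub_zero, smul_smul, inv_mul_cancel₀ hr0.ne', one_smul]
      rw [e, norm_smul, norm_inv, Real.norm_of_nonneg hr0.le]
      have h5 : ‖∫ τ in (0:ℝ)..r, (f x - f (x + τ))‖ ≤ ε * |r - 0| := by
        apply intervalIntegral.norm_integral_le_of_norm_le_const
        intro τ hτ
        rw [Set.uIoc_of_le hr0.le] at hτ
        have := hδ' (x + τ) (by rw [Real.dist_eq, add_sub_cancel_left, abs_of_pos hτ.1]; linarith [hτ.2])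
        rw [dist_comm, dist_eq_norm] at this
        exact this.le
      rw [sub_zero, abs_of_pos hr0] at h5
      calc r⁻¹ * _ ≤ r⁻¹ * (ε * r) := mul_le_mul_of_nonneg_left h5 (by positivity)
        _ = ε := by field_simp
    have h6 : 0 ≤ 4 * A * r ^ (1/4 : ℝ) := by positivity
    linarith
  intro x ρ h1 h2
  have b1 := hv x ρ h1 h2
  have b2 := hv (x + ρ) ρ h1 h2
  have b3 : ‖M (x + ρ) ρ - M x ρ‖ ≤ A * ρ ^ (1/4 : ℝ) := by
    have e : M (x + ρ) ρ - M x ρ = ρ⁻¹ • ∫ τ in (0:ℝ)..ρ, (f (x + τ + ρ) - f (x + τ)) := by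
      rw [intervalIntegral.integral_sub (Continuous.intervalIntegrable (by fun_prop) _ _)
        (Continuous.intervalIntegrable (by fun_prop) _ _), smul_sub]
      simp only [hM, add_right_comm]
    rw [e, norm_smul, norm_inv, Real.norm_of_nonneg h1.le]
    calc ρ⁻¹ * _ ≤ ρ⁻¹ * (ρ * (A * ρ ^ (1/4 : ℝ))) := mul_le_mul_of_nonneg_left (hJ x ρ h1 h2) (by positivity)
      _ = _ := by field_simp
  have e : f (x + ρ) - f x = (f (x + ρ) - M (x + ρ) ρ) + (M (x + ρ) ρ - M x ρ) - (f x - M x ρ) := by abel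
  rw [e]
  refine (norm_sub_le _ _).trans ?_
  have := norm_add_le (f (x + ρ) - M (x + ρ) ρ) (M (x + ρ) ρ - M x ρ)
  linarith

lemma modulus_aux (f : ℝ → E3) (hf : Continuous f) (L : ℝ) (hL : 1 ≤ L)
    (hper : ∀ t, f (t + L) = f t) (s B : ℝ) (hs : s ∈ Set.Ioo (1/2 : ℝ) 1) (hB : 0 < B)
    (hE : ∫⁻ h in Set.Ioc (0:ℝ) 1, ENNReal.ofReal
      ((∫ t in (0:ℝ)..L, ‖f (t + h) - f t‖ ^ 2) * h ^ (-2 - s)) ≤ ENNReal.ofReal (B / (1 - s))) :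
    ∀ x ρ, 0 < ρ → ρ ≤ 1/4 → ‖f (x + ρ) - f x‖ ≤ 9 * √(80 * B) * ρ ^ (1/4 : ℝ) := by
  set φ : ℝ → ℝ := fun h => ∫ t in (0:ℝ)..L, ‖f (t + h) - f t‖ ^ 2 with hφ
  have hcont : Continuous φ := by
    apply intervalIntegral.continuous_parametric_intervalIntegral_of_continuous'
    fun_prop
  have hshift : ∀ h k, ∫ t in (0:ℝ)..L, ‖f (t + h + k) - f (t + h)‖ ^ 2 = φ k := by
    intro h k
    have e1 := intervalIntegral.integral_comp_add_right (a := 0) (b := L) (fun t => ‖f (t + k) - f t‖ ^ 2) h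
    rw [e1]
    have hp : Function.Periodic (fun t => ‖f (t + k) - f t‖ ^ 2) L := by
      intro t
      simp only [hper, show t + L + k = t + k + L by ring]
    have e2 := hp.intervalIntegral_add_eq h 0
    rw [zero_add] at e2
    rw [zero_add, add_comm L, e2]
  have hL0 : (0:ℝ) ≤ L := by linarith
  have hci : ∀ g : ℝ → ℝ, Continuous g → IntervalIntegrable g volume 0 L :=
    fun g hg => hg.intervalIntegrable _ _
  have sq2 : ∀ a b : E3, ‖a + b‖ ^ 2 ≤ 2 * ‖a‖ ^ 2 + 2 * ‖b‖ ^ 2 := by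
    intro a b
    have h1 := norm_add_le a b
    have h2 := norm_nonneg (a + b)
    nlinarith [sq_nonneg (‖a‖ - ‖b‖)]
  have key := phi_bound_aux φ hcont
    (fun h => intervalIntegral.integral_nonneg hL0 (fun u _ => by positivity)) ?_ ?_ s B hs hB hE
  · refine telescope_aux f hf L hL hper (√(80 * B)) (by positivity) ?_
    intro h h1 h2
    rw [Real.sq_sqrt (by positivity)]
    exact key h h1 h2
  · intro h k
    rw [← hshift h k]
    simp only [hφ]
    rw [← intervalIntegral.integral_const_mul, ← intervalIntegral.integral_const_mul,
      ← intervalIntegral.integral_add (hci _ (by fun_prop)) (hci _ (by fun_prop))]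
    refine intervalIntegral.integral_mono_on hL0 (hci _ (by fun_prop)) (hci _ (by fun_prop)) ?_
    intro t _
    have : f (t + (h + k)) - f t = (f (t + h) - f t) + (f (t + h + k) - f (t + h)) := by
      rw [← add_assoc]; abel
    rw [this]; exact sq2 _ _
  · intro h k
    rw [← hshift h k]
    simp only [hφ]
    rw [← intervalIntegral.integral_const_mul, ← intervalIntegral.integral_const_mul,
      ← intervalIntegral.integral_add (hci _ (by fun_prop)) (hci _ (by fun_prop))]
    refine intervalIntegral.integral_mono_on hL0 (hci _ (by fun_prop)) (hci _ (by fun_prop)) ?_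
    intro t _
    have : f (t + h) - f t = (f (t + (h + k)) - f t) + -(f (t + h + k) - f (t + h)) := by
      rw [← add_assoc]; abel
    rw [this]
    refine (sq2 _ _).trans ?_
    rw [norm_neg]

lemma kernel_lower_aux (s : ℝ) (hs : s ∈ Set.Ioo (1/2 : ℝ) 1) (x y : E3) (hx : ‖x‖ = 1) (hy : ‖y‖ = 1)
    (D : ℝ) (hD : 0 < D) (hD2 : D ≤ 2) (hxy : ‖x - y‖ ≤ D) :
    ENNReal.ofReal (D ^ (-2 - s) / 16) ≤ kernelK s x y := by
  obtain ⟨hs0, hs1⟩ := hs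
  have hin : 2 * ⟪x, y⟫ = 2 - ‖x - y‖ ^ 2 := by
    rw [norm_sub_sq_real, hx, hy]; ring
  have hpt : ∀ t ∈ Set.Ioc (1:ℝ) (1 + D), ENNReal.ofReal (D ^ (-3 - s) / 16) ≤
      ENNReal.ofReal (t * (t ^ 2 + 1 - 2 * t * ⟪x, y⟫) ^ (-(3 + s)/2)) := by
    intro t ht
    apply ENNReal.ofReal_le_ofReal
    have e : t ^ 2 + 1 - 2 * t * ⟪x, y⟫ = (t - 1) ^ 2 + t * ‖x - y‖ ^ 2 := by
      have : 2 * t * ⟪x, y⟫ = t * (2 * ⟪x, y⟫) := by ring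
      rw [this, hin]; ring
    rw [e]
    have h1 : 0 < t - 1 := by linarith [ht.1]
    have h2 : t - 1 ≤ D := by linarith [ht.2]
    have h3 : 0 < (t - 1) ^ 2 + t * ‖x - y‖ ^ 2 := by
      have : 0 ≤ t * ‖x - y‖ ^ 2 := mul_nonneg (by linarith) (by positivity)
      positivity
    have h4 : (t - 1) ^ 2 + t * ‖x - y‖ ^ 2 ≤ (2 * D) ^ 2 := by
      have a1 : (t - 1) ^ 2 ≤ D ^ 2 := pow_le_pow_left₀ h1.le h2 2
      have a2 : ‖x - y‖ ^ 2 ≤ D ^ 2 := pow_le_pow_left₀ (norm_nonneg _) hxy 2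
      have a3 : t * ‖x - y‖ ^ 2 ≤ 3 * D ^ 2 :=
        mul_le_mul (by linarith) a2 (by positivity) (by norm_num)
      nlinarith
    have h5 : ((2 * D) ^ 2) ^ (-(3 + s)/2) ≤ ((t - 1) ^ 2 + t * ‖x - y‖ ^ 2) ^ (-(3 + s)/2) :=
      Real.rpow_le_rpow_of_nonpos h3 h4 (by linarith)
    have h6 : ((2 * D) ^ 2) ^ (-(3 + s)/2) = 2 ^ (-3 - s) * D ^ (-3 - s) := by
      rw [← Real.rpow_natCast, ← Real.rpow_mul (by positivity), ← Real.mul_rpow (by norm_num) hD.le]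
      congr 1
      push_cast; ring
    have h7 : (1:ℝ) / 16 ≤ 2 ^ (-3 - s) := by
      have : (2:ℝ) ^ (-4:ℝ) ≤ 2 ^ (-3 - s) := Real.rpow_le_rpow_of_exponent_le (by norm_num) (by linarith)
      refine le_trans (le_of_eq ?_) this
      rw [Real.rpow_neg (by norm_num)]; norm_num
    have h8 : 0 ≤ D ^ (-3 - s) := by positivity
    have h9 : D ^ (-3 - s) / 16 ≤ ((t - 1) ^ 2 + t * ‖x - y‖ ^ 2) ^ (-(3 + s)/2) := by
      rw [h6] at h5
      nlinarith
    have h10 : 0 ≤ ((t - 1) ^ 2 + t * ‖x - y‖ ^ 2) ^ (-(3 + s)/2) := by positivity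
    nlinarith [ht.1]
  calc ENNReal.ofReal (D ^ (-2 - s) / 16)
      = ENNReal.ofReal (D ^ (-3 - s) / 16) * volume (Set.Ioc (1:ℝ) (1 + D)) := by
        rw [Real.volume_Ioc, ← ENNReal.ofReal_mul (by positivity)]
        congr 1
        rw [show (-2 - s) = (-3 - s) + 1 by ring, Real.rpow_add hD, Real.rpow_one]
        ring
    _ = ∫⁻ t in Set.Ioc (1:ℝ) (1 + D), ENNReal.ofReal (D ^ (-3 - s) / 16) := by
        rw [setLIntegral_const]
    _ ≤ ∫⁻ t in Set.Ioc (1:ℝ) (1 + D), ENNReal.ofReal (t * (t ^ 2 + 1 - 2 * t * ⟪x, y⟫) ^ (-(3 + s)/2)) :=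
        setLIntegral_mono' measurableSet_Ioc hpt
    _ ≤ _ := lintegral_mono_set (fun t ht => by
        have := ht.1
        exact Set.mem_Ioi.2 (by linarith))

lemma cross_apply_aux (a b : E3) : cross a b 0 = a 1 * b 2 - a 2 * b 1 ∧
    cross a b 1 = a 2 * b 0 - a 0 * b 2 ∧ cross a b 2 = a 0 * b 1 - a 1 * b 0 := by
  simp [cross]

lemma inner_coord_aux (a b : E3) : ⟪a, b⟫ = a 0 * b 0 + a 1 * b 1 + a 2 * b 2 := by
  simp [PiLp.inner_apply, Fin.sum_univ_three]
  ring

lemma norm_sq_coord_aux (a : E3) : ‖a‖ ^ 2 = a 0 ^ 2 + a 1 ^ 2 + a 2 ^ 2 := by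
  rw [← real_inner_self_eq_norm_sq, inner_coord_aux]; ring

lemma cross_norm_aux (a b : E3) : ‖cross a b‖ ≤ ‖a‖ * ‖b‖ := by
  refine abs_le_of_sq_le_sq' ?_ (by positivity) |>.2
  rw [mul_pow, norm_sq_coord_aux, norm_sq_coord_aux, norm_sq_coord_aux]
  obtain ⟨h0, h1, h2⟩ := cross_apply_aux a b
  rw [h0, h1, h2]
  nlinarith [sq_nonneg (a 0 * b 0 + a 1 * b 1 + a 2 * b 2)]

lemma cross_sub_aux (a b c d : E3) : cross a b - cross c d = cross (a - c) b + cross c (b - d) := by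
  ext i
  obtain ⟨h0, h1, h2⟩ := cross_apply_aux a b
  obtain ⟨k0, k1, k2⟩ := cross_apply_aux c d
  obtain ⟨l0, l1, l2⟩ := cross_apply_aux (a - c) b
  obtain ⟨m0, m1, m2⟩ := cross_apply_aux c (b - d)
  fin_cases i
  · simp only [PiLp.sub_apply, PiLp.add_apply, Fin.zero_eta, Fin.mk_one, Fin.reduceFinMk, h0, k0, l0, m0]; ring
  · simp only [PiLp.sub_apply, PiLp.add_apply, Fin.zero_eta, Fin.mk_one, Fin.reduceFinMk, h1, k1, l1, m1]; ring
  · simp only [PiLp.sub_apply, PiLp.add_apply, Fin.zero_eta, Fin.mk_one, Fin.reduceFinMk, h2, k2, l2, m2]; ring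

lemma cross_cross_aux (a b : E3) (ha : ‖a‖ = 1) (hab : ⟪a, b⟫ = 0) : cross (cross a b) a = b := by
  have hn := norm_sq_coord_aux a
  rw [ha] at hn
  rw [inner_coord_aux] at hab
  ext i
  obtain ⟨h0, h1, h2⟩ := cross_apply_aux a b
  obtain ⟨k0, k1, k2⟩ := cross_apply_aux (cross a b) a
  fin_cases i
  · simp only [Fin.zero_eta, Fin.mk_one, Fin.reduceFinMk, h0, k0, h1, h2]
    linear_combination (-b 0) * hn - a 0 * hab
  · simp only [Fin.zero_eta, Fin.mk_one, Fin.reduceFinMk, h0, k1, h1, h2]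
    linear_combination (-b 1) * hn - a 1 * hab
  · simp only [Fin.zero_eta, Fin.mk_one, Fin.reduceFinMk, h0, k2, h1, h2]
    linear_combination (-b 2) * hn - a 2 * hab

lemma cross_continuous_aux (f g : ℝ → E3) (hf : Continuous f) (hg : Continuous g) :
    Continuous (fun t => cross (f t) (g t)) := by
  unfold cross
  refine (PiLp.continuous_toLp 2 (fun _ : Fin 3 => ℝ)).comp ?_
  refine continuous_pi ?_
  intro i
  fin_cases i <;> simp <;> fun_prop

/-- Basic facts on the curve. -/
lemma curve_facts_aux (γ : ℝ → E3) (L : ℝ) (hγ : ContDiff ℝ 2 γ) (hper : Function.Periodic γ L)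
    (hu : ∀ t, ‖γ t‖ = 1) (hu' : ∀ t, ‖deriv γ t‖ = 1) :
    Continuous (fun t => cross (γ t) (deriv γ t)) ∧
    (∀ t, cross (γ (t + L)) (deriv γ (t + L)) = cross (γ t) (deriv γ t)) ∧
    (∀ t, HasDerivAt γ (deriv γ t) t) ∧
    (∀ t u, ‖γ t - γ u‖ ≤ |t - u|) ∧
    (∀ t u, ‖deriv γ t - deriv γ u‖ ≤
      ‖cross (γ t) (deriv γ t) - cross (γ u) (deriv γ u)‖ + ‖γ t - γ u‖) ∧
    (∀ t, ‖cross (γ t) (deriv γ t)‖ ≤ 1) ∧ (∀ t, ⟪γ t, deriv γ t⟫ = 0) := by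
  have hd : ∀ t, HasDerivAt γ (deriv γ t) t := fun t =>
    (hγ.differentiable (by norm_num) t).hasDerivAt
  have hcd : Continuous (deriv γ) := hγ.continuous_deriv (by norm_num)
  have hperd : ∀ t, deriv γ (t + L) = deriv γ t := by
    intro t
    rw [← deriv_comp_add_const]
    congr 1
    funext x; exact hper x
  have horth : ∀ t, ⟪γ t, deriv γ t⟫ = 0 := by
    intro t
    have h1 := (hd t).inner ℝ (hd t)
    have h2 : (fun t => ⟪γ t, γ t⟫) = fun _ => (1:ℝ) := by
      funext x; rw [real_inner_self_eq_norm_sq, hu]; norm_num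
    rw [h2] at h1
    have := h1.unique (hasDerivAt_const t (1:ℝ))
    rw [real_inner_comm (γ t) (deriv γ t)] at this
    rw [real_inner_comm] at this ⊢
    linarith
  have hn : ∀ t, ‖cross (γ t) (deriv γ t)‖ ≤ 1 := by
    intro t
    have := cross_norm_aux (γ t) (deriv γ t)
    rw [hu, hu'] at this; linarith
  refine ⟨cross_continuous_aux _ _ hγ.continuous hcd, fun t => by rw [hper, hperd], hd, ?_, ?_, hn, horth⟩
  · intro t u
    have := Convex.norm_image_sub_le_of_norm_hasDerivWithin_le (f := γ) (C := 1) (s := Set.univ)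
      (x := u) (y := t) (fun x _ => (hd x).hasDerivWithinAt) (fun x _ => (hu' x).le) convex_univ trivial trivial
    simpa using this
  · intro t u
    have e : deriv γ t - deriv γ u =
      cross (cross (γ t) (deriv γ t)) (γ t) - cross (cross (γ u) (deriv γ u)) (γ u) := by
      rw [cross_cross_aux _ _ (hu t) (horth t), cross_cross_aux _ _ (hu u) (horth u)]
    rw [e, cross_sub_aux]
    refine (norm_add_le _ _).trans ?_
    have h1 := cross_norm_aux (cross (γ t) (deriv γ t) - cross (γ u) (deriv γ u)) (γ t)
    have h2 := cross_norm_aux (cross (γ u) (deriv γ u)) (γ t - γ u)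
    rw [hu, mul_one] at h1
    have h3 := mul_le_mul_of_nonneg_right (hn u) (norm_nonneg (γ t - γ u))
    linarith

lemma periodic_lintegral_aux (g : ℝ → ℝ≥0∞) (L : ℝ) (hL : 0 < L) (hg : Function.Periodic g L) (t : ℝ) :
    ∫⁻ h in Set.Ioc 0 L, g (t + h) = ∫⁻ u in Set.Ioc 0 L, g u := by
  have h1 := (measurePreserving_add_left (volume : Measure ℝ) t).setLIntegral_comp_emb
    (measurableEmbedding_addLeft t) g (Set.Ioc 0 L)
  rw [h1, Set.image_const_add_Ioc, add_zero]
  have h2 := (isAddFundamentalDomain_Ioc hL t).setLIntegral_eq (isAddFundamentalDomain_Ioc hL 0) g ?_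
  · rw [h2, zero_add]
  · rintro ⟨z, hz⟩ x
    obtain ⟨n, rfl⟩ := AddSubgroup.mem_zmultiples_iff.1 hz
    change g (n • L + x) = g x
    rw [add_comm]
    exact hg.zsmul n x

lemma energy_mod_aux (C₀ : ℝ) (hC₀ : 0 < C₀) (s : ℝ) (hs : s ∈ Set.Ioo (1/2 : ℝ) 1) (L : ℝ) (hL : 1 ≤ L)
    (γ f : ℝ → E3) (hf : Continuous f) (hγp : Function.Periodic γ L) (hfp : ∀ t, f (t + L) = f t)
    (hu : ∀ t, ‖γ t‖ = 1) (hlip : ∀ t u, ‖γ t - γ u‖ ≤ |t - u|)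
    (hE : (∫⁻ t in Set.Icc (0:ℝ) L, ∫⁻ u in Set.Icc (0:ℝ) L,
            ENNReal.ofReal (‖f t - f u‖ ^ 2) * kernelK s (γ t) (γ u)) ≤ ENNReal.ofReal (C₀ * L))
    (hLs : L ≤ C₀ / (1 - s)) :
    ∫⁻ h in Set.Ioc (0:ℝ) 1, ENNReal.ofReal
      ((∫ t in (0:ℝ)..L, ‖f (t + h) - f t‖ ^ 2) * h ^ (-2 - s)) ≤ ENNReal.ofReal ((16 * C₀ ^ 2) / (1 - s)) := by
  have hL0 : 0 < L := by linarith
  have hs3 : 0 < 1 - s := by linarith [hs.2]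
  calc ∫⁻ h in Set.Ioc (0:ℝ) 1, ENNReal.ofReal ((∫ t in (0:ℝ)..L, ‖f (t + h) - f t‖ ^ 2) * h ^ (-2 - s))
      = ∫⁻ h in Set.Ioc (0:ℝ) 1, ∫⁻ t in Set.Ioc (0:ℝ) L,
          ENNReal.ofReal (‖f (t + h) - f t‖ ^ 2) * ENNReal.ofReal (h ^ (-2 - s)) := by
        refine setLIntegral_congr_fun measurableSet_Ioc ?_
        intro h hh
        have hm : Continuous fun t => ‖f (t + h) - f t‖ ^ 2 := by fun_prop
        simp only []
        rw [lintegral_mul_const' _ _ ENNReal.ofReal_ne_top, intervalIntegral.integral_of_le hL0.le,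
          ENNReal.ofReal_mul (integral_nonneg (fun _ => by positivity)),
          ofReal_integral_eq_lintegral_ofReal]
        · exact (hm.integrableOn_Icc (a := 0) (b := L)).mono_set Set.Ioc_subset_Icc_self
        · exact Filter.Eventually.of_forall fun _ => by positivity
    _ = ∫⁻ t in Set.Ioc (0:ℝ) L, ∫⁻ h in Set.Ioc (0:ℝ) 1,
          ENNReal.ofReal (‖f (t + h) - f t‖ ^ 2) * ENNReal.ofReal (h ^ (-2 - s)) := by
        apply lintegral_lintegral_swap
        apply Measurable.aemeasurable
        have m1 : Measurable fun p : ℝ × ℝ => ENNReal.ofReal (‖f (p.2 + p.1) - f p.2‖ ^ 2) := by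
          apply Measurable.ennreal_ofReal
          apply Continuous.measurable
          fun_prop
        have m2 : Measurable fun p : ℝ × ℝ => ENNReal.ofReal (p.1 ^ (-2 - s)) :=
          ((measurable_fst).pow_const _).ennreal_ofReal
        exact m1.mul m2
    _ ≤ ∫⁻ t in Set.Ioc (0:ℝ) L, 16 * ∫⁻ u in Set.Ioc (0:ℝ) L,
            ENNReal.ofReal (‖f t - f u‖ ^ 2) * kernelK s (γ t) (γ u) := by
        refine lintegral_mono ?_
        intro t
        simp only []
        rw [← periodic_lintegral_aux (fun u => ENNReal.ofReal (‖f t - f u‖ ^ 2) * kernelK s (γ t) (γ u)) L hL0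
          (fun u => by simp only [hfp, hγp u]) t, ← lintegral_const_mul' _ _ (by simp)]
        refine le_trans ?_ (lintegral_mono_set (Set.Ioc_subset_Ioc_right hL))
        refine setLIntegral_mono' measurableSet_Ioc ?_
        intro h hh
        have hk := kernel_lower_aux s hs (γ t) (γ (t + h)) (hu _) (hu _) h hh.1 (by linarith [hh.2])
          ((hlip _ _).trans (by rw [show t - (t + h) = -h by ring, abs_neg, abs_of_pos hh.1]))
        have hk2 : ENNReal.ofReal (h ^ (-2 - s)) ≤ 16 * kernelK s (γ t) (γ (t + h)) := by
          calc ENNReal.ofReal (h ^ (-2 - s)) = 16 * ENNReal.ofReal (h ^ (-2 - s) / 16) := by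
                rw [show (16:ℝ≥0∞) = ENNReal.ofReal 16 by simp, ← ENNReal.ofReal_mul (by norm_num)]
                congr 1; ring
            _ ≤ _ := by gcongr
        rw [norm_sub_rev]
        calc _ ≤ ENNReal.ofReal (‖f t - f (t + h)‖ ^ 2) * (16 * kernelK s (γ t) (γ (t + h))) := by gcongr
          _ = _ := by ring
    _ = 16 * ∫⁻ t in Set.Ioc (0:ℝ) L, ∫⁻ u in Set.Ioc (0:ℝ) L,
            ENNReal.ofReal (‖f t - f u‖ ^ 2) * kernelK s (γ t) (γ u) := lintegral_const_mul' _ _ (by simp)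
    _ ≤ 16 * ∫⁻ t in Set.Icc (0:ℝ) L, ∫⁻ u in Set.Icc (0:ℝ) L,
            ENNReal.ofReal (‖f t - f u‖ ^ 2) * kernelK s (γ t) (γ u) := by
        gcongr
        · exact Set.Ioc_subset_Icc_self
        · exact Set.Ioc_subset_Icc_self
    _ ≤ 16 * ENNReal.ofReal (C₀ * L) := by gcongr
    _ ≤ _ := by
        rw [show (16:ℝ≥0∞) = ENNReal.ofReal 16 by simp, ← ENNReal.ofReal_mul (by norm_num)]
        apply ENNReal.ofReal_le_ofReal
        have := mul_le_mul_of_nonneg_left hLs hC₀.le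
        calc 16 * (C₀ * L) ≤ 16 * (C₀ * (C₀ / (1 - s))) := by linarith
          _ = _ := by ring

lemma small_aux (C₀ : ℝ) (hC₀ : 0 < C₀) : ∃ r : ℝ, 0 < r ∧ r ≤ 1/4 ∧
    ∀ ρ, 0 < ρ → ρ ≤ r → 9 * √(80 * (16 * C₀ ^ 2)) * ρ ^ (1/4 : ℝ) ≤ 1/8 := by
  set A := 9 * √(80 * (16 * C₀ ^ 2)) with hA
  have hA0 : 0 < A := by positivity
  refine ⟨min (1/4) ((1 / (8 * A)) ^ (4:ℝ)), by positivity, min_le_left _ _, ?_⟩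
  intro ρ h1 h2
  have h3 : ρ ^ (1/4 : ℝ) ≤ ((1 / (8 * A)) ^ (4:ℝ)) ^ (1/4 : ℝ) :=
    Real.rpow_le_rpow h1.le (h2.trans (min_le_right _ _)) (by norm_num)
  rw [← Real.rpow_mul (by positivity), show (4:ℝ) * (1/4) = 1 by norm_num, Real.rpow_one] at h3
  calc A * ρ ^ (1/4 : ℝ) ≤ A * (1 / (8 * A)) := mul_le_mul_of_nonneg_left h3 hA0.le
    _ = 1/8 := by field_simp

lemma geometry_aux (γ γ' ν : ℝ → E3) (L r δ : ℝ) (hd : ∀ t, HasDerivAt γ (γ' t) t)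
    (hu : ∀ t, ‖γ t‖ = 1) (hu' : ∀ t, ‖γ' t‖ = 1) (horth : ∀ t, ⟪γ t, γ' t⟫ = 0)
    (hper : Function.Periodic γ L)
    (hinj : ∀ t u, t < u → u < t + L → γ t ≠ γ u)
    (hlip : ∀ t u, ‖γ t - γ u‖ ≤ |t - u|)
    (hd2 : ∀ t u, ‖γ' t - γ' u‖ ≤ ‖ν t - ν u‖ + ‖γ t - γ u‖)
    (hmod : ∀ x y, |x - y| ≤ r → ‖ν x - ν y‖ ≤ 1/8)
    (hr : 0 < r) (hr4 : r ≤ 1/4) (hδ : 0 < δ) (hδr : 32 * δ ≤ r)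
    (a u : ℝ) (hau : a + 1 ≤ u) (hua : u + 1 ≤ a + L) (h1 : ‖γ u - γ a‖ ≤ δ) (h2 : ‖ν u - ν a‖ ≤ δ) :
    ∃ b, ‖γ b - γ a‖ ≤ 3 * δ ∧ 1/2 < ‖ν b - ν a‖ := by
  set η := r / 2 with hη
  set e := γ' a with he
  set y : ℝ → ℝ := fun τ => ⟪γ τ, e⟫ with hy
  have hγc : Continuous γ := continuous_iff_continuousAt.2 fun t => (hd t).continuousAt
  have hyc : Continuous y := by simp only [hy]; fun_prop
  have hyd : ∀ τ, HasDerivAt y ⟪γ' τ, e⟫ τ := by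
    intro τ
    have := (hd τ).inner ℝ (hasDerivAt_const τ e)
    simpa using this
  have hyd2 : ∀ τ, ‖γ' τ - e‖ ≤ 1 → 1/2 ≤ ⟪γ' τ, e⟫ := by
    intro τ h
    have := norm_sub_sq_real (γ' τ) e
    rw [hu', he, hu'] at this
    have h3 : ‖γ' τ - γ' a‖ ^ 2 ≤ 1 := by
      have := norm_nonneg (γ' τ - γ' a)
      nlinarith
    linarith
  have hmono : ∀ c, ‖γ' c - e‖ ≤ 3/4 → ∀ x z, c - η ≤ x → x ≤ z → z ≤ c + η → (z - x) / 2 ≤ y z - y x := by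
    intro c hc x z hx hxz hz
    have hmon : MonotoneOn (fun τ => y τ - τ / 2) (Set.Icc (c - η) (c + η)) := by
      refine monotoneOn_of_deriv_nonneg (convex_Icc _ _) (by fun_prop) ?_ ?_
      · intro τ _
        exact ((hyd τ).sub ((hasDerivAt_id τ).div_const 2)).differentiableAt.differentiableWithinAt
      · intro τ hτ
        rw [interior_Icc] at hτ
        have hdd := ((hyd τ).sub ((hasDerivAt_id τ).div_const 2)).deriv
        have hle : |τ - c| ≤ r := by rw [abs_le]; constructor <;> linarith [hτ.1, hτ.2]
        have hle2 : |τ - c| ≤ 1/8 := by rw [abs_le]; constructor <;> linarith [hτ.1, hτ.2]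
        have k1 := hd2 τ c
        have k2 := hmod τ c hle
        have k3 := hlip τ c
        have k4 : ‖γ' τ - e‖ ≤ ‖γ' τ - γ' c‖ + ‖γ' c - e‖ := by
          have : γ' τ - e = (γ' τ - γ' c) + (γ' c - e) := by abel
          rw [this]; exact norm_add_le _ _
        have k5 := hyd2 τ (by linarith)
        have : deriv (fun τ => y τ - τ / 2) τ = ⟪γ' τ, e⟫ - 1 / 2 := hdd
        rw [this]; linarith
    have := hmon ⟨hx, by linarith⟩ ⟨by linarith, hz⟩ hxz
    simp only [] at this
    linarith
  have hya : y a = 0 := horth a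
  have hma := hmono a (by rw [he, sub_self, norm_zero]; norm_num)
  have hdu : ‖γ' u - e‖ ≤ 3/4 := by
    have := hd2 u a
    linarith
  have hmu := hmono u hdu
  have hyu : |y u| ≤ δ := by
    have h3 : y u = ⟪γ u - γ a, e⟫ := by
      rw [inner_sub_left]
      have : ⟪γ a, e⟫ = 0 := horth a
      rw [this, sub_zero]
    rw [h3]
    have := abs_real_inner_le_norm (γ u - γ a) e
    rw [he, hu', mul_one] at this
    exact this.trans h1
  rw [abs_le] at hyu
  obtain ⟨t1, ht1, hyt1⟩ : ∃ t1 ∈ Set.Icc (u - 2 * δ) (u + 2 * δ), y t1 = 0 := by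
    have m1 := hmu (u - 2 * δ) u (by linarith) (by linarith) (by linarith)
    have m2 := hmu u (u + 2 * δ) (by linarith) (by linarith) (by linarith)
    have := intermediate_value_Icc (by linarith : u - 2 * δ ≤ u + 2 * δ) hyc.continuousOn
    exact this ⟨by linarith, by linarith⟩
  have hgt1 : ‖γ t1 - γ a‖ ≤ 3 * δ := by
    have e1 : γ t1 - γ a = (γ t1 - γ u) + (γ u - γ a) := by abel
    rw [e1]
    have := hlip t1 u
    have h3 : |t1 - u| ≤ 2 * δ := by rw [abs_le]; constructor <;> linarith [ht1.1, ht1.2]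
    linarith [norm_add_le (γ t1 - γ u) (γ u - γ a)]
  have hKc : IsCompact (Set.Icc (a + η) (a + L - η) ∩ y ⁻¹' {0}) :=
    isCompact_Icc.inter_right (isClosed_singleton.preimage hyc)
  have ht1K : t1 ∈ Set.Icc (a + η) (a + L - η) ∩ y ⁻¹' {0} :=
    ⟨⟨by linarith [ht1.1], by linarith [ht1.2]⟩, hyt1⟩
  have hpc : Continuous fun τ => ⟪γ τ, γ a⟫ := by fun_prop
  obtain ⟨b, hbK, hbmax⟩ := hKc.exists_isMaxOn ⟨t1, ht1K⟩ hpc.continuousOn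
  have hnorm : ∀ τ, ‖γ τ - γ a‖ ^ 2 = 2 - 2 * ⟪γ τ, γ a⟫ := by
    intro τ
    rw [norm_sub_sq_real, hu, hu]; ring
  have hgb : ‖γ b - γ a‖ ≤ 3 * δ := by
    refine le_trans ?_ hgt1
    have h3 : ⟪γ t1, γ a⟫ ≤ ⟪γ b, γ a⟫ := hbmax ht1K
    refine abs_le_of_sq_le_sq' ?_ (norm_nonneg _) |>.2
    rw [hnorm, hnorm]; linarith
  refine ⟨b, hgb, ?_⟩
  by_contra hcon
  rw [not_lt] at hcon
  have hdb : ‖γ' b - e‖ ≤ 3/4 := by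
    have := hd2 b a
    linarith
  have hmb := hmono b hdb
  have hyb : y b = 0 := hbK.2
  refine sphere_aux γ L hγc hper hinj hu e (hu' a) a b (by linarith [hbK.1.1]) (by linarith [hbK.1.2])
    hya hyb ?_ ?_ η (by linarith) (by linarith) ?_ ?_ ?_ ?_
  · have := hnorm b
    nlinarith [norm_nonneg (γ b - γ a)]
  · intro t ht
    obtain ⟨t', ht', htt⟩ := hper.exists_mem_Ico (by linarith : 0 < L) t (a - η)
    rw [htt] at ht ⊢
    have hyt : y t' = 0 := ht
    by_cases hc : t' ≤ a + η
    · left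
      rcases le_total t' a with h3 | h3
      · have := hma t' a ht'.1 h3 (by linarith)
        rw [show t' = a by linarith]
      · have := hma a t' (by linarith) h3 hc
        rw [show t' = a by linarith]
    · right
      rw [not_le] at hc
      exact hbmax ⟨⟨hc.le, by linarith [ht'.2]⟩, hyt⟩
  · intro t h3 h4
    have := hma t a h3 h4.le (by linarith)
    change y t < 0
    linarith
  · intro t h3 h4
    have := hma a t (by linarith) h3.le h4
    change 0 < y t
    linarith
  · intro t h3 h4
    have := hmb t b h3 h4.le (by linarith)
    change y t < 0
    linarith
  · intro t h3 h4
    have := hmb b t (by linarith) h3.le h4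
    change 0 < y t
    linarith

lemma pigeon_aux {α : Type*} (T : Finset α) (N : ℕ) (c : ℕ → α) (hc : ∀ k, c k ∈ T) :
    ∃ S : Finset ℕ, S ⊆ Finset.range N ∧ N ≤ S.card + T.card ∧
      ∀ k ∈ S, ∃ k', k < k' ∧ k' < N ∧ c k = c k' := by
  classical
  refine ⟨(Finset.range N).filter (fun k => ∃ k', k < k' ∧ k' < N ∧ c k = c k'), Finset.filter_subset _ _, ?_, ?_⟩
  · have h1 := Finset.card_filter_add_card_filter_not (s := Finset.range N)
      (fun k => ∃ k', k < k' ∧ k' < N ∧ c k = c k')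
    rw [Finset.card_range] at h1
    have h2 : ((Finset.range N).filter (fun k => ¬ ∃ k', k < k' ∧ k' < N ∧ c k = c k')).card ≤ T.card := by
      refine Finset.card_le_card_of_injOn c (fun k _ => hc k) ?_
      intro k hk l hl hkl
      rw [Finset.mem_coe, Finset.mem_filter, Finset.mem_range] at hk hl
      by_contra hne
      rcases lt_or_gt_of_ne hne with h | h
      · exact hk.2 ⟨l, h, hl.1, hkl⟩
      · exact hl.2 ⟨k, h, hk.1, hkl.symm⟩
    omega
  · intro k hk
    exact (Finset.mem_filter.1 hk).2

lemma box_aux (F : ℝ → ℝ≥0∞) (S : Finset ℕ) (L δ c : ℝ) (hδ : 0 < δ) (hδ1 : δ ≤ 1) (hc : 0 ≤ c)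
    (hS : ∀ k ∈ S, (k:ℝ) + 1 ≤ L)
    (hF : ∀ k ∈ S, ∀ t ∈ Set.Ioc (k:ℝ) (k + δ), ENNReal.ofReal c ≤ F t) :
    ENNReal.ofReal (S.card * (c * δ)) ≤ ∫⁻ t in Set.Icc (0:ℝ) L, F t := by
  have hsub : (⋃ k ∈ S, Set.Ioc (k:ℝ) (k + δ)) ⊆ Set.Icc (0:ℝ) L := by
    intro t ht
    simp only [Set.mem_iUnion] at ht
    obtain ⟨k, hk, ht⟩ := ht
    have h1 := hS k hk
    have h2 : (0:ℝ) ≤ k := Nat.cast_nonneg k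
    exact ⟨by linarith [ht.1], by linarith [ht.2]⟩
  refine le_trans ?_ (lintegral_mono_set hsub)
  rw [lintegral_biUnion_finset]
  · have : ENNReal.ofReal (S.card * (c * δ)) = ∑ k ∈ S, ENNReal.ofReal (c * δ) := by
      rw [Finset.sum_const, nsmul_eq_mul, ENNReal.ofReal_mul (Nat.cast_nonneg _), ENNReal.ofReal_natCast]
    rw [this]
    refine Finset.sum_le_sum ?_
    intro k hk
    calc ENNReal.ofReal (c * δ) = ∫⁻ t in Set.Ioc (k:ℝ) (k + δ), ENNReal.ofReal c := by
          rw [setLIntegral_const, Real.volume_Ioc, ENNReal.ofReal_mul hc]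
          congr 2; ring
      _ ≤ _ := setLIntegral_mono' measurableSet_Ioc (hF k hk)
  · intro k _ l _ hkl
    rw [Function.onFun, Set.disjoint_left]
    intro t ht ht'
    rcases lt_or_gt_of_ne hkl with h | h
    · have : (k:ℝ) + 1 ≤ l := by exact_mod_cast h
      linarith [ht.2, ht'.1]
    · have : (l:ℝ) + 1 ≤ k := by exact_mod_cast h
      linarith [ht.1, ht'.2]
  · intro k _; exact measurableSet_Ioc

lemma inner_box_aux (s : ℝ) (hs : s ∈ Set.Ioo (1/2 : ℝ) 1) (γ ν : ℝ → E3) (L r δ : ℝ) (hL : 1 ≤ L)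
    (hu : ∀ t, ‖γ t‖ = 1) (hγp : Function.Periodic γ L) (hνp : Function.Periodic ν L)
    (hlip : ∀ t u, ‖γ t - γ u‖ ≤ |t - u|)
    (hmod : ∀ x y, |x - y| ≤ r → ‖ν x - ν y‖ ≤ 1/8) (hr4 : r ≤ 1/4) (hδ : 0 < δ) (hδr : 32 * δ ≤ r)
    (a b : ℝ) (h1 : ‖γ b - γ a‖ ≤ 3 * δ) (h2 : 1/2 < ‖ν b - ν a‖) (t : ℝ) (ht : t ∈ Set.Ioc a (a + δ)) :
    ENNReal.ofReal (1/16 * ((5 * δ) ^ (-2 - s) / 16) * δ) ≤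
      ∫⁻ u in Set.Icc (0:ℝ) L, ENNReal.ofReal (‖ν t - ν u‖ ^ 2) * kernelK s (γ t) (γ u) := by
  have hL0 : 0 < L := by linarith
  obtain ⟨b', hb', e1, e2⟩ : ∃ b' ∈ Set.Ico (0:ℝ) L, γ b = γ b' ∧ ν b = ν b' := by
    refine ⟨toIcoMod hL0 0 b, toIcoMod_mem_Ico' hL0 b, ?_, ?_⟩
    · rw [toIcoMod, hγp.sub_zsmul_eq]
    · rw [toIcoMod, hνp.sub_zsmul_eq]
  rw [e1] at h1
  rw [e2] at h2
  obtain ⟨q, hq0, hq1, hq2, hq3⟩ : ∃ q, 0 ≤ q ∧ q + δ ≤ L ∧ q ≤ b' ∧ b' ≤ q + δ := by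
    by_cases h : b' + δ ≤ L
    · exact ⟨b', hb'.1, h, le_rfl, by linarith⟩
    · exact ⟨b' - δ, by linarith, by linarith [hb'.2], by linarith, by linarith⟩
  have hsub : Set.Ioc q (q + δ) ⊆ Set.Icc (0:ℝ) L := fun v hv => ⟨by linarith [hv.1], by linarith [hv.2]⟩
  refine le_trans ?_ (lintegral_mono_set hsub)
  have hta : |t - a| ≤ δ := by rw [abs_le]; constructor <;> linarith [ht.1, ht.2]
  calc ENNReal.ofReal (1/16 * ((5 * δ) ^ (-2 - s) / 16) * δ)
      = ∫⁻ v in Set.Ioc q (q + δ), ENNReal.ofReal (1/16 * ((5 * δ) ^ (-2 - s) / 16)) := by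
        rw [setLIntegral_const, Real.volume_Ioc, ENNReal.ofReal_mul (by positivity)]
        congr 2; ring
    _ ≤ _ := by
        refine setLIntegral_mono' measurableSet_Ioc ?_
        intro v hv
        have hvb : |v - b'| ≤ δ := by rw [abs_le]; constructor <;> linarith [hv.1, hv.2]
        have g1 : ‖γ t - γ v‖ ≤ 5 * δ := by
          have e : γ t - γ v = (γ t - γ a) - (γ b' - γ a) - (γ v - γ b') := by abel
          rw [e]
          have k1 := norm_sub_le ((γ t - γ a) - (γ b' - γ a)) (γ v - γ b')
          have k2 := norm_sub_le (γ t - γ a) (γ b' - γ a)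
          have k3 := hlip t a
          have k4 := hlip v b'
          linarith
        have g2 : 1/4 ≤ ‖ν t - ν v‖ := by
          have e : ν b' - ν a = (ν t - ν a) - (ν t - ν v) - (ν v - ν b') := by abel
          rw [e] at h2
          have k1 := norm_sub_le ((ν t - ν a) - (ν t - ν v)) (ν v - ν b')
          have k2 := norm_sub_le (ν t - ν a) (ν t - ν v)
          have k3 := hmod t a (by linarith)
          have k4 := hmod v b' (by linarith)
          linarith
        rw [ENNReal.ofReal_mul (by norm_num)]
        have g3 := kernel_lower_aux s hs (γ t) (γ v) (hu t) (hu v) (5 * δ) (by linarith) (by linarith) g1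
        have g4 : (1:ℝ)/16 ≤ ‖ν t - ν v‖ ^ 2 := by nlinarith
        gcongr

lemma inj_aux (γ : ℝ → E3) (L : ℝ) (hL : 0 < L) (hper : Function.Periodic γ L)
    (hinj : Set.InjOn γ (Set.Ico 0 L)) : ∀ t u, t < u → u < t + L → γ t ≠ γ u := by
  intro t u h1 h2 h
  have k : ∀ x, γ (toIcoMod hL 0 x) = γ x := fun x => by rw [toIcoMod, hper.sub_zsmul_eq]
  have h3 := hinj (toIcoMod_mem_Ico' hL t) (toIcoMod_mem_Ico' hL u) (by rw [k, k, h])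
  rw [toIcoMod, toIcoMod, zsmul_eq_mul, zsmul_eq_mul] at h3
  have h4 : u - t = ((toIcoDiv hL 0 u - toIcoDiv hL 0 t : ℤ) : ℝ) * L := by push_cast; linarith
  have h5 : (0:ℝ) < ((toIcoDiv hL 0 u - toIcoDiv hL 0 t : ℤ) : ℝ) := by
    by_contra hc; rw [not_lt] at hc; nlinarith
  have h6 : ((toIcoDiv hL 0 u - toIcoDiv hL 0 t : ℤ) : ℝ) < 1 := by
    by_contra hc; rw [not_lt] at hc; nlinarith
  have h5' : (0:ℤ) < toIcoDiv hL 0 u - toIcoDiv hL 0 t := by exact_mod_cast h5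
  have h6' : toIcoDiv hL 0 u - toIcoDiv hL 0 t < (1:ℤ) := by exact_mod_cast h6
  omega

lemma cover_aux (δ : ℝ) (hδ : 0 < δ) : ∃ T : Finset (E3 × E3), ∀ p : E3 × E3, ‖p‖ ≤ 1 →
    ∃ z ∈ T, dist p z < δ := by
  have := (isCompact_closedBall (0 : E3 × E3) 1).totallyBounded
  rw [Metric.totallyBounded_iff] at this
  obtain ⟨t, ht, hcov⟩ := this δ hδ
  refine ⟨ht.toFinset, fun p hp => ?_⟩
  have h1 := hcov (mem_closedBall_zero_iff.2 hp)
  simp only [Set.mem_iUnion] at h1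
  obtain ⟨z, hz, hz2⟩ := h1
  exact ⟨z, by simpa using hz, Metric.mem_ball.1 hz2⟩

/-- for every `C₀ > 0` there is `C = C(C₀)` such that for all `s ∈ (1/2,1)`:
if `γ₀` is a closed simple arc-length curve on `S²` of length `L`, with unit normal
`ν(t) = γ₀(t) × γ₀'(t)`, satisfying
`∫_0^L ∫_0^L |ν(t)−ν(t̄)|² k_s(γ₀(t),γ₀(t̄)) dt dt̄ ≤ C₀ L` and `L ≤ C₀/(1−s)`,
then `L ≤ C`. -/
theorem length_bound_of_stable_curve (C₀ : ℝ) (hC₀ : 0 < C₀) :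
    ∃ C : ℝ, 0 < C ∧ ∀ s ∈ Set.Ioo (1/2 : ℝ) 1,
      ∀ L : ℝ, 0 < L → ∀ γ₀ : ℝ → E3,
        ContDiff ℝ 2 γ₀ → Function.Periodic γ₀ L →
        (∀ t, ‖γ₀ t‖ = 1) → (∀ t, ‖deriv γ₀ t‖ = 1) →
        Set.InjOn γ₀ (Set.Ico 0 L) →
        (∫⁻ t in Set.Icc (0:ℝ) L, ∫⁻ u in Set.Icc (0:ℝ) L,
            ENNReal.ofReal
              (‖cross (γ₀ t) (deriv γ₀ t) - cross (γ₀ u) (deriv γ₀ u)‖ ^ 2) *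
              kernelK s (γ₀ t) (γ₀ u))
          ≤ ENNReal.ofReal (C₀ * L) →
        L ≤ C₀ / (1 - s) →
        L ≤ C := by
  obtain ⟨r, hr, hr4, hsmall⟩ := small_aux C₀ hC₀
  set D : ℝ := min (5 * (r / 32)) ((1 / (12800 * C₀)) ^ 2) with hD
  have hD0 : 0 < D := by positivity
  obtain ⟨δ, hDδ⟩ : ∃ δ, 5 * δ = D := ⟨D / 5, by ring⟩
  have hδ : 0 < δ := by linarith
  have hD1 : D ≤ 5 * (r / 32) := min_le_left _ _
  have hδr : 32 * δ ≤ r := by linarith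
  have hDC : 12800 * C₀ ≤ D ^ (-(1/2) : ℝ) := by
    have h1 : ((1 / (12800 * C₀)) ^ 2) ^ (-(1/2) : ℝ) ≤ D ^ (-(1/2) : ℝ) :=
      Real.rpow_le_rpow_of_nonpos hD0 (min_le_right _ _) (by norm_num)
    refine le_trans (le_of_eq ?_) h1
    rw [← Real.rpow_natCast, ← Real.rpow_mul (by positivity)]
    norm_num [Real.rpow_neg_one]
  obtain ⟨T, hT⟩ := cover_aux (δ / 2) (by linarith)
  refine ⟨2 * (T.card + 1), by positivity, ?_⟩
  intro s hs L hL γ hγ hper hu hu' hinj hE hLs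
  by_contra hcon
  rw [not_le] at hcon
  have hTc : (0:ℝ) ≤ T.card := Nat.cast_nonneg _
  have hL1 : 1 ≤ L := by linarith
  obtain ⟨hνc, hνp, hd, hlip, hd2, hn, horth⟩ := curve_facts_aux γ L hγ hper hu hu'
  set ν : ℝ → E3 := fun t => cross (γ t) (deriv γ t) with hν
  have hE2 := energy_mod_aux C₀ hC₀ s hs L hL1 γ ν hνc hper hνp hu hlip hE hLs
  have hmod0 := modulus_aux ν hνc L hL1 hνp s (16 * C₀ ^ 2) hs (by positivity) hE2
  have hmod1 : ∀ x y, x ≤ y → y - x ≤ r → ‖ν y - ν x‖ ≤ 1/8 := by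
    intro x y hxy hyr
    rcases hxy.eq_or_lt with h | h
    · rw [h, sub_self, norm_zero]; norm_num
    · have := hmod0 x (y - x) (by linarith) (by linarith)
      rw [add_sub_cancel] at this
      exact this.trans (hsmall _ (by linarith) hyr)
  have hmod : ∀ x y, |x - y| ≤ r → ‖ν x - ν y‖ ≤ 1/8 := by
    intro x y hxy
    rw [abs_le] at hxy
    rcases le_total x y with h | h
    · rw [norm_sub_rev]; exact hmod1 x y h (by linarith)
    · exact hmod1 y x h (by linarith)
  have hinj' := inj_aux γ L hL hper hinj
  have hcell : ∀ k : ℕ, ∃ z ∈ T, dist (γ k, ν k) z < δ / 2 := by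
    intro k
    apply hT
    rw [Prod.norm_mk]
    exact max_le (hu _).le (hn _)
  choose c hcT hcd using hcell
  obtain ⟨S, hSN, hScard, hS⟩ := pigeon_aux T ⌊L⌋₊ c hcT
  have hfl : ((⌊L⌋₊ : ℕ) : ℝ) ≤ L := Nat.floor_le hL.le
  have hfl2 : L < ⌊L⌋₊ + 1 := Nat.lt_floor_add_one L
  set κ : ℝ := 1/16 * ((5 * δ) ^ (-2 - s) / 16) * δ with hκ
  have hκ0 : 0 ≤ κ := by positivity
  have hbox := box_aux (fun t => ∫⁻ u in Set.Icc (0:ℝ) L,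
      ENNReal.ofReal (‖ν t - ν u‖ ^ 2) * kernelK s (γ t) (γ u)) S L δ κ hδ (by linarith) hκ0 ?_ ?_
  · have h1 := (ENNReal.ofReal_le_ofReal_iff (by positivity)).1 (hbox.trans hE)
    have h2 : 2 * C₀ ≤ κ * δ := by
      have e1 : κ * δ = D ^ (-2 - s) * D ^ (2:ℝ) / 6400 := by
        rw [hκ, hDδ, show δ = D / 5 by linarith]
        rw [show ((2:ℝ)) = ((2:ℕ):ℝ) by norm_num, Real.rpow_natCast]
        push_cast
        ring
      have e2 : D ^ (-(1/2) : ℝ) ≤ D ^ (-2 - s) * D ^ (2:ℝ) := by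
        rw [← Real.rpow_add hD0]
        exact Real.rpow_le_rpow_of_exponent_ge hD0 (by linarith) (by linarith [hs.1])
      rw [e1]; linarith
    have h3 : (⌊L⌋₊ : ℝ) ≤ S.card + T.card := by exact_mod_cast hScard
    have h4 : L - 1 - T.card ≤ S.card := by linarith
    have h5 : (L - 1 - T.card) * (2 * C₀) ≤ S.card * (κ * δ) :=
      mul_le_mul h4 h2 (by positivity) (by positivity)
    nlinarith
  · intro k hk
    have := Finset.mem_range.1 (hSN hk)
    have h1 : (k:ℝ) + 1 ≤ ⌊L⌋₊ := by exact_mod_cast this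
    linarith
  · intro k hk t ht
    obtain ⟨k', hkk, hkN, hck⟩ := hS k hk
    have d1 : dist ((γ k', ν k') : E3 × E3) (γ k, ν k) ≤ δ := by
      have a1 := hcd k
      have a2 := hcd k'
      rw [← hck] at a2
      have := dist_triangle_right ((γ k', ν k') : E3 × E3) (γ k, ν k) (c k)
      linarith
    rw [Prod.dist_eq, max_le_iff, dist_eq_norm, dist_eq_norm] at d1
    have h1 : (k:ℝ) + 1 ≤ k' := by exact_mod_cast hkk
    have h2 : (k':ℝ) + 1 ≤ ⌊L⌋₊ := by exact_mod_cast hkN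
    have h3 : (0:ℝ) ≤ k := Nat.cast_nonneg _
    obtain ⟨b, hb1, hb2⟩ := geometry_aux γ (deriv γ) ν L r δ hd hu hu' horth hper hinj' hlip hd2 hmod
      hr hr4 hδ hδr k k' h1 (by linarith) d1.1 d1.2
    exact inner_box_aux s hs γ ν L r δ hL1 hu hper hνp hlip hmod hr4 hδ hδr k b hb1 hb2 t ht
end
end

section
/- There exists a universal constant C such that for every s ∈ (1/2,1) and every δ > 0 the following holds. Let γ₀ : [0,5π] → S² be a C² map with |γ₀'(t)| = 1 for all t, and set ν(t) := γ₀(t) × γ₀'(t). If (1−s) ∫_0^{5π} ∫_0^{5π} |ν(t)−ν(t̄)|² k_s(γ₀(t), γ₀(t̄)) dt dt̄ ≤ δ, then there exists e ∈ ℝ³ such that |ν(t) − e| ≤ C δ^{1/2} for all t ∈ [0,5π] and |ν(t) − ν(t̄)| ≤ C δ^{1/2} |t−t̄|^{1/4} for all t, t̄ ∈ [0,5π]. -/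
open MeasureTheory
open scoped ENNReal RealInnerProductSpace

noncomputable section

/-- Squared increment. -/
def sqInc (N : ℝ → E3) (h x : ℝ) : ℝ≥0∞ := ENNReal.ofReal (‖N (x + h) - N x‖ ^ 2)

/-- Integrated squared increment at step `h` in `[a,b]`. -/
def incF (N : ℝ → E3) (a b h : ℝ) : ℝ≥0∞ := ∫⁻ x in Set.Icc a (b - h), sqInc N h x

lemma measurable_sqInc {N : ℝ → E3} (hN : Continuous N) (h : ℝ) : Measurable (sqInc N h) := by
  unfold sqInc
  exact ENNReal.measurable_ofReal.comp (by fun_prop)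

lemma ofReal_sq_le_two {A B D : ℝ} (hA : 0 ≤ A) (h : A ≤ B + D) :
    ENNReal.ofReal (A ^ 2) ≤ 2 * ENNReal.ofReal (B ^ 2) + 2 * ENNReal.ofReal (D ^ 2) := by
  have h2 : (2 : ℝ≥0∞) = ENNReal.ofReal 2 := by norm_num
  rw [h2, ← ENNReal.ofReal_mul (by norm_num), ← ENNReal.ofReal_mul (by norm_num),
    ← ENNReal.ofReal_add (by positivity) (by positivity)]
  apply ENNReal.ofReal_le_ofReal
  nlinarith [sq_nonneg (B - D)]

lemma incF_double {N : ℝ → E3} (hN : Continuous N) (a b : ℝ) {h : ℝ} (hh : 0 ≤ h) :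
    incF N a b (2 * h) ≤ 4 * incF N a b h := by
  have hp : ∀ x, sqInc N (2 * h) x ≤ 2 * sqInc N h (x + h) + 2 * sqInc N h x := by
    intro x
    unfold sqInc
    apply ofReal_sq_le_two
    · exact norm_nonneg _
    · have e : x + h + h = x + 2 * h := by ring
      rw [e]
      exact norm_sub_le_norm_sub_add_norm_sub _ _ _
  have hm := measurable_sqInc hN h
  have h1 : ∫⁻ x in Set.Icc a (b - 2 * h), sqInc N h (x + h) ≤ incF N a b h := by
    have := (measurePreserving_add_right (volume : Measure ℝ) h).setLIntegral_comp_preimage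
      (s := Set.Icc (a + h) (b - h)) measurableSet_Icc hm
    have e : (fun x => x + h) ⁻¹' Set.Icc (a + h) (b - h) = Set.Icc a (b - 2 * h) := by
      ext x; simp only [Set.mem_preimage, Set.mem_Icc]
      constructor <;> rintro ⟨h1, h2⟩ <;> constructor <;> linarith
    rw [e] at this
    rw [this]
    exact lintegral_mono_set (Set.Icc_subset_Icc (by linarith) le_rfl)
  have h2 : ∫⁻ x in Set.Icc a (b - 2 * h), sqInc N h x ≤ incF N a b h :=
    lintegral_mono_set (Set.Icc_subset_Icc le_rfl (by linarith))
  calc incF N a b (2 * h)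
      ≤ ∫⁻ x in Set.Icc a (b - 2 * h), (2 * sqInc N h (x + h) + 2 * sqInc N h x) :=
        lintegral_mono hp
    _ = 2 * (∫⁻ x in Set.Icc a (b - 2 * h), sqInc N h (x + h))
        + 2 * (∫⁻ x in Set.Icc a (b - 2 * h), sqInc N h x) := by
        rw [lintegral_add_right _ (hm.const_mul 2), lintegral_const_mul' _ _ (by norm_num),
          lintegral_const_mul' _ _ (by norm_num)]
    _ ≤ 2 * incF N a b h + 2 * incF N a b h := by gcongr
    _ = 4 * incF N a b h := by ring

/-- Weighted integral of increments on `(0,ρ]`. -/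
def incJ (N : ℝ → E3) (a b s ρ : ℝ) : ℝ≥0∞ :=
  ∫⁻ h in Set.Ioc 0 ρ, incF N a b h * ENNReal.ofReal (h ^ (-2 - s))

lemma incJ_half {N : ℝ → E3} (hN : Continuous N) (a b s r : ℝ) :
    incJ N a b s r ≤ ENNReal.ofReal ((2:ℝ) ^ (1 - s)) * incJ N a b s (r / 2) := by
  have e : (fun x : ℝ => 2 * x) '' Set.Ioc 0 (r / 2) = Set.Ioc 0 r := by
    ext x; simp only [Set.mem_image, Set.mem_Ioc]
    constructor
    · rintro ⟨y, ⟨h1, h2⟩, rfl⟩; constructor <;> linarith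
    · rintro ⟨h1, h2⟩; exact ⟨x / 2, ⟨by linarith, by linarith⟩, by ring⟩
  unfold incJ
  rw [← e, lintegral_image_eq_lintegral_abs_deriv_mul measurableSet_Ioc (f' := fun _ => 2)
    (fun x _ => by simpa using ((hasDerivAt_id x).const_mul 2).hasDerivWithinAt)
    (fun x _ y _ h => by simpa using h), ← lintegral_const_mul' _ _ (by simp)]
  apply setLIntegral_mono' measurableSet_Ioc
  intro x hx
  have hx0 := hx.1
  calc ENNReal.ofReal |2| * (incF N a b (2 * x) * ENNReal.ofReal ((2 * x) ^ (-2 - s)))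
      ≤ ENNReal.ofReal |2| * ((4 * incF N a b x) * ENNReal.ofReal ((2 * x) ^ (-2 - s))) := by
        gcongr; exact incF_double hN a b hx0.le
    _ = incF N a b x * ((ENNReal.ofReal 2 * ENNReal.ofReal 4) *
          ENNReal.ofReal ((2 * x) ^ (-2 - s))) := by
        have : (4 : ℝ≥0∞) = ENNReal.ofReal 4 := by norm_num
        rw [this, abs_two]; ring
    _ = incF N a b x * (ENNReal.ofReal ((2:ℝ) ^ (1 - s)) * ENNReal.ofReal (x ^ (-2 - s))) := by
        congr 1
        rw [← ENNReal.ofReal_mul (by norm_num), ← ENNReal.ofReal_mul (by norm_num),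
          ← ENNReal.ofReal_mul (by positivity), Real.mul_rpow (by norm_num) hx0.le]
        congr 1
        have : (1 - s) = 3 + (-2 - s) := by ring
        rw [this, Real.rpow_add (by norm_num)]
        norm_num [mul_assoc]
    _ = _ := by ring

lemma incJ_annulus {N : ℝ → E3} (hN : Continuous N) (a b : ℝ) {s r : ℝ} (hs0 : 0 ≤ s)
    (hs1 : s < 1) (hr : 0 ≤ r) (hfin : incJ N a b s r ≠ ∞) :
    ∫⁻ h in Set.Ioc (r / 2) r, incF N a b h * ENNReal.ofReal (h ^ (-2 - s))
      ≤ ENNReal.ofReal (1 - s) * incJ N a b s r := by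
  set T := ∫⁻ h in Set.Ioc (r / 2) r, incF N a b h * ENNReal.ofReal (h ^ (-2 - s))
  have hsplit : incJ N a b s r = incJ N a b s (r / 2) + T := by
    unfold incJ
    rw [← Set.Ioc_union_Ioc_eq_Ioc (a := (0:ℝ)) (b := r / 2) (c := r) (by linarith) (by linarith),
      lintegral_union measurableSet_Ioc]
    rw [Set.disjoint_left]; intro x h1 h2; exact absurd h1.2 (not_le.mpr h2.1)
  have hle : incJ N a b s (r / 2) ≤ incJ N a b s r := by rw [hsplit]; exact le_self_add
  have hfin2 : incJ N a b s (r / 2) ≠ ∞ := ne_top_of_le_ne_top hfin hle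
  have h2 : (2:ℝ) ^ (1 - s) ≤ 1 + (1 - s) := by
    have := rpow_one_add_le_one_add_mul_self (s := 1) (by norm_num) (p := 1 - s)
      (by linarith) (by linarith)
    norm_num at this ⊢; linarith
  have h3 : incJ N a b s (r / 2) + T ≤
      incJ N a b s (r / 2) + ENNReal.ofReal (1 - s) * incJ N a b s (r / 2) := by
    rw [← hsplit]
    refine (incJ_half hN a b s r).trans ?_
    calc _ ≤ ENNReal.ofReal (1 + (1 - s)) * incJ N a b s (r / 2) := by gcongr
      _ = _ := by
        rw [ENNReal.ofReal_add (by norm_num) (by linarith), ENNReal.ofReal_one]; ring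
  have h4 := (ENNReal.add_le_add_iff_left hfin2).1 h3
  exact h4.trans (by gcongr)

lemma incJ_le {N : ℝ → E3} (hN : Continuous N) (a b s : ℝ) :
    incJ N a b s (b - a) ≤ ∫⁻ x in Set.Icc a b, ∫⁻ y in Set.Icc a b,
      ENNReal.ofReal (‖N x - N y‖ ^ 2) * ENNReal.ofReal (|x - y| ^ (-2 - s)) := by
  let W : Set (ℝ × ℝ) := {p | 0 < p.1 ∧ a ≤ p.2 ∧ p.2 + p.1 ≤ b}
  have hW : MeasurableSet W := by
    exact (measurableSet_lt measurable_const measurable_fst).inter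
      ((measurableSet_le measurable_const measurable_snd).inter
        (measurableSet_le (measurable_snd.add measurable_fst) measurable_const))
  let G : ℝ × ℝ → ℝ≥0∞ := W.indicator
    (fun p => sqInc N p.1 p.2 * ENNReal.ofReal (p.1 ^ (-2 - s)))
  have hG : Measurable G := by
    apply Measurable.indicator _ hW
    unfold sqInc
    have m1 : Measurable fun p : ℝ × ℝ => ENNReal.ofReal (‖N (p.2 + p.1) - N p.2‖ ^ 2) :=
      ENNReal.measurable_ofReal.comp (by fun_prop)
    have m2 : Measurable fun p : ℝ × ℝ => ENNReal.ofReal (p.1 ^ (-2 - s)) :=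
      ENNReal.measurable_ofReal.comp (measurable_fst.pow_const _)
    exact m1.mul m2
  have h1 : incJ N a b s (b - a) ≤ ∫⁻ h, ∫⁻ x, G (h, x) := by
    unfold incJ
    rw [← lintegral_indicator measurableSet_Ioc]
    apply lintegral_mono
    intro h
    by_cases hh : h ∈ Set.Ioc 0 (b - a)
    · simp only [Set.indicator_of_mem hh]
      unfold incF
      rw [← lintegral_mul_const' _ _ (by simp), ← lintegral_indicator measurableSet_Icc]
      apply lintegral_mono
      intro x
      by_cases hx : x ∈ Set.Icc a (b - h)
      · simp only [Set.indicator_of_mem hx]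
        have : (h, x) ∈ W := ⟨hh.1, hx.1, by have := hx.2; dsimp only; linarith⟩
        simp only [G, Set.indicator_of_mem this]
        exact le_rfl
      · simp [Set.indicator_of_notMem hx]
    · simp [Set.indicator_of_notMem hh]
  refine h1.trans ?_
  rw [lintegral_lintegral_swap (f := fun h x => G (h, x)) hG.aemeasurable,
    ← lintegral_indicator measurableSet_Icc]
  apply lintegral_mono
  intro x
  by_cases hx : x ∈ Set.Icc a b
  · simp only [Set.indicator_of_mem hx]
    rw [← lintegral_indicator measurableSet_Icc]
    rw [← lintegral_add_right_eq_self (Set.indicator (Set.Icc a b) _) x]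
    apply lintegral_mono
    intro h
    by_cases hw : (h, x) ∈ W
    · have h0 : 0 < h := hw.1
      have h2 : x + h ≤ b := hw.2.2
      have hm : h + x ∈ Set.Icc a b := ⟨by linarith [hx.1], by linarith⟩
      simp only [G, Set.indicator_of_mem hw, Set.indicator_of_mem hm]
      have e : |x - (h + x)| = h := by
        rw [show x - (h + x) = -h by ring, abs_neg, abs_of_pos h0]
      rw [e, sqInc, norm_sub_rev, add_comm h x]
    · simp [G, Set.indicator_of_notMem hw]
  · simp only [Set.indicator_of_notMem hx]
    have : ∀ h, G (h, x) = 0 := by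
      intro h
      apply Set.indicator_of_notMem
      rintro ⟨h1, h2, h3⟩
      dsimp only at h1 h2 h3
      exact hx ⟨h2, by linarith⟩
    simp [this]

lemma osc_bound {N : ℝ → E3} (hN : Continuous N) {a b s P M : ℝ} (hab : a < b) (hs0 : 0 ≤ s)
    (hs1 : s < 1) (hP : 0 ≤ P) (hM : 0 ≤ M)
    (hPN : ∀ x y, a ≤ x → x ≤ a + (b - a) / 256 → b - (b - a) / 256 ≤ y → y ≤ b →
      P ≤ ‖N y - N x‖)
    (hint : ENNReal.ofReal (1 - s) * ∫⁻ x in Set.Icc a b, ∫⁻ y in Set.Icc a b,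
      ENNReal.ofReal (‖N x - N y‖ ^ 2) * ENNReal.ofReal (|x - y| ^ (-2 - s)) ≤ ENNReal.ofReal M) :
    P ^ 2 ≤ 512 ^ 2 * M * (b - a) ^ s := by
  set r := b - a with hr
  have hr0 : 0 < r := by linarith
  have hJM : ENNReal.ofReal (1 - s) * incJ N a b s r ≤ ENNReal.ofReal M :=
    le_trans (by gcongr; exact incJ_le hN a b s) hint
  have hfin : incJ N a b s r ≠ ∞ := by
    intro h
    rw [h, ENNReal.mul_top (by simpa using hs1)] at hJM
    simp at hJM
  have hT := (incJ_annulus hN a b hs0 hs1 hr0.le hfin).trans hJM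
  have hlow : ENNReal.ofReal (P ^ 2 * (r / 512) * r ^ (-2 - s) * (r / 512)) ≤
      ∫⁻ h in Set.Ioc (r / 2) r, incF N a b h * ENNReal.ofReal (h ^ (-2 - s)) := by
    calc ENNReal.ofReal (P ^ 2 * (r / 512) * r ^ (-2 - s) * (r / 512))
        = ∫⁻ h in Set.Ioc (r - r / 256) (r - r / 512),
            ENNReal.ofReal (P ^ 2 * (r / 512) * r ^ (-2 - s)) := by
          rw [setLIntegral_const, Real.volume_Ioc, ENNReal.ofReal_mul (by positivity)]
          congr 2; ring
      _ ≤ ∫⁻ h in Set.Ioc (r - r / 256) (r - r / 512),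
            incF N a b h * ENNReal.ofReal (h ^ (-2 - s)) := by
          apply setLIntegral_mono' measurableSet_Ioc
          intro h hh
          have hh1 := hh.1
          have hh2 := hh.2
          rw [ENNReal.ofReal_mul (by positivity)]
          apply mul_le_mul' _ (ENNReal.ofReal_le_ofReal
            (Real.rpow_le_rpow_of_nonpos (by linarith) (by linarith) (by linarith)))
          calc ENNReal.ofReal (P ^ 2 * (r / 512))
              ≤ ENNReal.ofReal (P ^ 2) * ENNReal.ofReal (b - h - a) := by
                rw [ENNReal.ofReal_mul (by positivity)]
                gcongr
                linarith
            _ = ∫⁻ x in Set.Icc a (b - h), ENNReal.ofReal (P ^ 2) := by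
                rw [setLIntegral_const, Real.volume_Icc]
            _ ≤ incF N a b h := by
                apply setLIntegral_mono' measurableSet_Icc
                intro x hx
                apply ENNReal.ofReal_le_ofReal
                have := hPN x (x + h) hx.1 (by linarith [hx.2]) (by linarith [hx.1])
                  (by linarith [hx.2])
                gcongr
      _ ≤ _ := lintegral_mono_set (Set.Ioc_subset_Ioc (by linarith) (by linarith))
  have h1 := (ENNReal.ofReal_le_ofReal_iff hM).1 (hlow.trans hT)
  have h2 : r ^ (-2 - s) * r ^ s * r ^ 2 = 1 := by
    rw [← Real.rpow_natCast r 2, ← Real.rpow_add hr0, ← Real.rpow_add hr0]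
    have : -2 - s + s + ((2:ℕ):ℝ) = 0 := by push_cast; ring
    rw [this, Real.rpow_zero]
  have hrs : 0 < r ^ s := Real.rpow_pos_of_pos hr0 s
  calc P ^ 2 = 512 ^ 2 * (P ^ 2 * (r / 512) * r ^ (-2 - s) * (r / 512)) * r ^ s := by
        linear_combination (-P ^ 2) * h2
    _ ≤ 512 ^ 2 * M * r ^ s := by gcongr

/-- One step of the absorption argument. -/
lemma holder_step {N : ℝ → E3} (hN : Continuous N) {L s M H : ℝ} (hL : L ≤ 16)
    (hs0 : 1 / 2 < s) (hs1 : s < 1) (hM : 0 ≤ M)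
    (hint : ENNReal.ofReal (1 - s) * ∫⁻ x in Set.Icc 0 L, ∫⁻ y in Set.Icc 0 L,
      ENNReal.ofReal (‖N x - N y‖ ^ 2) * ENNReal.ofReal (|x - y| ^ (-2 - s)) ≤ ENNReal.ofReal M)
    (hH : ∀ a b, 0 ≤ a → a ≤ b → b ≤ L → ‖N b - N a‖ ≤ H * (b - a) ^ (1 / 4 : ℝ))
    (hH0 : 0 ≤ H) :
    ∀ a b, 0 ≤ a → a ≤ b → b ≤ L →
      ‖N b - N a‖ ≤ (8192 * √M + H / 2) * (b - a) ^ (1 / 4 : ℝ) := by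
  intro a b ha hab hb
  rcases hab.eq_or_lt with rfl | hab'
  · simp
  set r := b - a with hr
  have hr0 : 0 < r := by linarith
  have hr16 : r ≤ 16 := by linarith
  set q := r ^ (1 / 4 : ℝ) with hq
  have hq0 : 0 < q := Real.rpow_pos_of_pos hr0 _
  by_contra! hcon
  set P := ‖N b - N a‖ - H / 2 * q with hPdef
  have hP : 8192 * √M * q < P := by rw [hPdef]; linarith
  have hP0 : 0 ≤ P := le_trans (by positivity) hP.le
  have hsmall : ∀ d, 0 ≤ d → d ≤ r / 256 → d ^ (1 / 4 : ℝ) ≤ q / 4 := by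
    intro d hd hdr
    have h1 : (r / 256) ^ (1 / 4 : ℝ) = q / 4 := by
      rw [Real.div_rpow hr0.le (by norm_num), show (256 : ℝ) = 4 ^ (4 : ℝ) by norm_num,
        ← Real.rpow_mul (by norm_num)]
      norm_num [hq]
    rw [← h1]
    exact Real.rpow_le_rpow hd hdr (by norm_num)
  have key := osc_bound hN hab' (by linarith) hs1 hP0 hM (s := s) (P := P) (M := M) (by
    intro x y h1 h2 h3 h4
    have e1 := hH a x ha h1 (by linarith)
    have e2 := hH y b (by linarith) h4 hb
    have e3 := mul_le_mul_of_nonneg_left (hsmall (x - a) (by linarith) (by linarith)) hH0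
    have e4 := mul_le_mul_of_nonneg_left (hsmall (b - y) (by linarith) (by linarith)) hH0
    have e5 : ‖N b - N a‖ ≤ ‖N b - N y‖ + ‖N y - N x‖ + ‖N x - N a‖ := by
      have := norm_sub_le_norm_sub_add_norm_sub (N b) (N y) (N a)
      have := norm_sub_le_norm_sub_add_norm_sub (N y) (N x) (N a)
      linarith
    rw [hPdef]; linarith) (by
    refine le_trans ?_ hint
    gcongr)
  have hrs : r ^ s ≤ 256 * q ^ 2 := by
    have e1 : q ^ 2 = r ^ (1 / 2 : ℝ) := by
      rw [hq, ← Real.rpow_natCast, ← Real.rpow_mul hr0.le]; norm_num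
    have e2 : r ^ s = r ^ (s - 1 / 2) * r ^ (1 / 2 : ℝ) := by
      rw [← Real.rpow_add hr0]; congr 1; ring
    rw [e1, e2]
    have e3 : r ^ (s - 1 / 2) ≤ 256 := by
      calc r ^ (s - 1 / 2) ≤ 16 ^ (s - 1 / 2) :=
            Real.rpow_le_rpow hr0.le hr16 (by linarith)
        _ ≤ 16 ^ (1 : ℝ) := Real.rpow_le_rpow_of_exponent_le (by norm_num) (by linarith)
        _ ≤ 256 := by norm_num
    gcongr
  have h3 : P ^ 2 ≤ (8192 * √M * q) ^ 2 := by
    calc P ^ 2 ≤ 512 ^ 2 * M * r ^ s := key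
      _ ≤ 512 ^ 2 * M * (256 * q ^ 2) := by gcongr
      _ = (8192 * √M * q) ^ 2 := by
        rw [mul_pow, mul_pow, Real.sq_sqrt hM]; ring
  have h4 := abs_le_of_sq_le_sq h3 (by positivity)
  linarith [le_abs_self P]

lemma holder_final {N : ℝ → E3} (hN : Continuous N) {L s M H : ℝ} (hL : L ≤ 16)
    (hs0 : 1 / 2 < s) (hs1 : s < 1) (hM : 0 ≤ M)
    (hint : ENNReal.ofReal (1 - s) * ∫⁻ x in Set.Icc 0 L, ∫⁻ y in Set.Icc 0 L,
      ENNReal.ofReal (‖N x - N y‖ ^ 2) * ENNReal.ofReal (|x - y| ^ (-2 - s)) ≤ ENNReal.ofReal M)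
    (hH : ∀ a b, 0 ≤ a → a ≤ b → b ≤ L → ‖N b - N a‖ ≤ H * (b - a) ^ (1 / 4 : ℝ))
    (hH0 : 0 ≤ H) :
    ∀ a b, 0 ≤ a → a ≤ b → b ≤ L →
      ‖N b - N a‖ ≤ 16384 * √M * (b - a) ^ (1 / 4 : ℝ) := by
  have hit : ∀ n : ℕ, ∀ a b, 0 ≤ a → a ≤ b → b ≤ L →
      ‖N b - N a‖ ≤ (16384 * √M + H * (1 / 2) ^ n) * (b - a) ^ (1 / 4 : ℝ) := by
    intro n
    induction n with
    | zero =>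
      intro a b ha hab hb
      refine (hH a b ha hab hb).trans ?_
      have : 0 ≤ b - a := by linarith
      gcongr
      have := Real.sqrt_nonneg M
      simp
    | succ n ih =>
      intro a b ha hab hb
      refine (holder_step hN hL hs0 hs1 hM hint ih (by positivity) a b ha hab hb).trans ?_
      apply le_of_eq
      rw [pow_succ]; ring
  intro a b ha hab hb
  have ht : Filter.Tendsto (fun n : ℕ => (16384 * √M + H * (1 / 2 : ℝ) ^ n) *
      (b - a) ^ (1 / 4 : ℝ)) Filter.atTop (nhds ((16384 * √M + H * 0) * (b - a) ^ (1 / 4 : ℝ))) :=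
    ((tendsto_const_nhds.add (tendsto_const_nhds.mul
      (tendsto_pow_atTop_nhds_zero_of_lt_one (by norm_num) (by norm_num)))).mul tendsto_const_nhds)
  have := ge_of_tendsto' ht (fun n => hit n a b ha hab hb)
  simpa using this

lemma kernelK_lower {s : ℝ} (hs0 : 0 ≤ s) (hs1 : s < 1) {x y : E3} (hx : ‖x‖ = 1) (hy : ‖y‖ = 1)
    {r : ℝ} (hr : 0 ≤ r) (hr16 : r ≤ 16) (hxy : ‖x - y‖ ≤ r) :
    ENNReal.ofReal (1 / 324 * r ^ (-2 - s)) ≤ kernelK s x y := by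
  rcases hr.eq_or_lt with rfl | hr0
  · rw [Real.zero_rpow (by linarith)]; simp
  have hin : 2 * ⟪x, y⟫ = 2 - ‖x - y‖ ^ 2 := by
    rw [norm_sub_sq_real, hx, hy]; ring
  have hd : ‖x - y‖ ^ 2 ≤ r ^ 2 := by gcongr
  unfold kernelK
  calc ENNReal.ofReal (1 / 324 * r ^ (-2 - s))
      = ∫⁻ t in Set.Ioc 1 (1 + r), ENNReal.ofReal (1 / 324 * r ^ (-3 - s)) := by
        rw [setLIntegral_const, Real.volume_Ioc, ← ENNReal.ofReal_mul (by positivity)]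
        congr 1
        have : -2 - s = (-3 - s) + 1 := by ring
        rw [this, Real.rpow_add hr0, Real.rpow_one]; ring
    _ ≤ ∫⁻ t in Set.Ioc 1 (1 + r),
          ENNReal.ofReal (t * (t ^ 2 + 1 - 2 * t * ⟪x, y⟫) ^ (-(3 + s)/2)) := by
        apply setLIntegral_mono' measurableSet_Ioc
        intro t ht
        have ht1 := ht.1
        have ht2 := ht.2
        apply ENNReal.ofReal_le_ofReal
        have e : t ^ 2 + 1 - 2 * t * ⟪x, y⟫ = (t - 1) ^ 2 + t * ‖x - y‖ ^ 2 := by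
          linear_combination (-t) * hin
        rw [e]
        have hpos : 0 < (t - 1) ^ 2 + t * ‖x - y‖ ^ 2 := by
          have : 0 < (t - 1) ^ 2 := by apply pow_pos; linarith
          positivity
        have hle : (t - 1) ^ 2 + t * ‖x - y‖ ^ 2 ≤ 18 * r ^ 2 := by
          have h1 : (t - 1) ^ 2 ≤ r ^ 2 := by
            apply pow_le_pow_left₀ <;> linarith
          have h2 : t * ‖x - y‖ ^ 2 ≤ 17 * r ^ 2 := by
            apply mul_le_mul <;> first | linarith | positivity
          linarith
        have h3 : (18 * r ^ 2) ^ (-(3 + s)/2) ≤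
            ((t - 1) ^ 2 + t * ‖x - y‖ ^ 2) ^ (-(3 + s)/2) :=
          Real.rpow_le_rpow_of_nonpos hpos hle (by linarith)
        have h4 : 1 / 324 * r ^ (-3 - s) ≤ (18 * r ^ 2) ^ (-(3 + s)/2) := by
          rw [Real.mul_rpow (by norm_num) (by positivity), ← Real.rpow_natCast r 2,
            ← Real.rpow_mul hr0.le]
          have e1 : ((2:ℕ):ℝ) * (-(3 + s)/2) = -3 - s := by push_cast; ring
          rw [e1]
          gcongr
          calc (1 / 324 : ℝ) = 18 ^ (-2 : ℝ) := by
                rw [Real.rpow_neg (by norm_num)]; norm_num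
            _ ≤ _ := Real.rpow_le_rpow_of_exponent_le (by norm_num) (by linarith)
        refine h4.trans (h3.trans ?_)
        exact le_mul_of_one_le_left (Real.rpow_nonneg hpos.le _) ht1.le
    _ ≤ _ := lintegral_mono_set (fun t ht => lt_trans one_pos ht.1)

lemma contDiffOn_cross {f g : ℝ → E3} {S : Set ℝ} (hf : ContDiffOn ℝ 1 f S)
    (hg : ContDiffOn ℝ 1 g S) : ContDiffOn ℝ 1 (fun t => cross (f t) (g t)) S := by
  have hf' := contDiffOn_euclidean.1 hf
  have hg' := contDiffOn_euclidean.1 hg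
  rw [contDiffOn_euclidean]
  intro i
  fin_cases i
  · exact ((hf' 1).mul (hg' 2)).sub ((hf' 2).mul (hg' 1))
  · exact ((hf' 2).mul (hg' 0)).sub ((hf' 0).mul (hg' 2))
  · exact ((hf' 0).mul (hg' 1)).sub ((hf' 1).mul (hg' 0))

/-- a universal constant `C` such that for every `s ∈ (1/2,1)`, `δ > 0` and
every `C²` arc-length arc `γ₀ : [0,5π] → S²` (with derivative `γ₀'`) whose normalized
squared nonlocal second fundamental form integral is at most `δ`, the normal vector
`ν = γ₀ × γ₀'` is `C δ^{1/2}`-close in `C^{1/4}([0,5π])` to some constant vector `e ∈ ℝ³`. -/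
theorem arc_normal_nearly_constant :
    ∃ C : ℝ, 0 < C ∧ ∀ s ∈ Set.Ioo (1/2 : ℝ) 1, ∀ δ : ℝ, 0 < δ →
      ∀ γ₀ γ₀' : ℝ → E3,
        ContDiffOn ℝ 2 γ₀ (Set.Icc 0 (5 * Real.pi)) →
        (∀ t ∈ Set.Icc 0 (5 * Real.pi),
          HasDerivWithinAt γ₀ (γ₀' t) (Set.Icc 0 (5 * Real.pi)) t) →
        (∀ t ∈ Set.Icc 0 (5 * Real.pi), ‖γ₀ t‖ = 1) →
        (∀ t ∈ Set.Icc 0 (5 * Real.pi), ‖γ₀' t‖ = 1) →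
        (ENNReal.ofReal (1 - s) *
            ∫⁻ t in Set.Icc 0 (5 * Real.pi), ∫⁻ u in Set.Icc 0 (5 * Real.pi),
              ENNReal.ofReal
                (‖cross (γ₀ t) (γ₀' t) - cross (γ₀ u) (γ₀' u)‖ ^ 2) *
                kernelK s (γ₀ t) (γ₀ u))
          ≤ ENNReal.ofReal δ →
        ∃ e : E3,
          (∀ t ∈ Set.Icc 0 (5 * Real.pi),
            ‖cross (γ₀ t) (γ₀' t) - e‖ ≤ C * δ ^ (1/2 : ℝ)) ∧
          (∀ t ∈ Set.Icc 0 (5 * Real.pi), ∀ u ∈ Set.Icc 0 (5 * Real.pi),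
            ‖cross (γ₀ t) (γ₀' t) - cross (γ₀ u) (γ₀' u)‖
              ≤ C * δ ^ (1/2 : ℝ) * |t - u| ^ (1/4 : ℝ)) := by
  refine ⟨16 * (16384 * 18), by norm_num, ?_⟩
  intro s hs δ hδ γ γ' hC hder hn1 hn2 hint
  set L := 5 * Real.pi with hL
  have hL0 : 0 < L := by positivity
  have hL16 : L ≤ 16 := by
    have := Real.pi_lt_d2; rw [hL]; linarith
  set ν : ℝ → E3 := fun t => cross (γ t) (γ' t) with hν
  have hs0 := hs.1
  have hs1 := hs.2
  -- regularity
  have hud : UniqueDiffOn ℝ (Set.Icc 0 L) := uniqueDiffOn_Icc hL0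
  have hγ' : ContDiffOn ℝ 1 γ' (Set.Icc 0 L) := by
    have h2 : ContDiffOn ℝ (1 + 1) γ (Set.Icc 0 L) := by
      rw [one_add_one_eq_two]; exact hC
    have := ((contDiffOn_succ_iff_derivWithin hud).1 h2).2.2
    exact this.congr fun t ht => ((hder t ht).derivWithin (hud t ht)).symm
  have hνC : ContDiffOn ℝ 1 ν (Set.Icc 0 L) :=
    contDiffOn_cross (hC.of_le (by norm_num)) hγ'
  obtain ⟨K, hK⟩ := hνC.exists_lipschitzOnWith (by norm_num) (convex_Icc 0 L) isCompact_Icc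
  -- continuous extension
  set N : ℝ → E3 := fun x => ν (max 0 (min L x)) with hNdef
  have hNc : Continuous N := by
    apply hνC.continuousOn.comp_continuous (by fun_prop)
    intro x
    exact ⟨le_max_left _ _, max_le hL0.le (min_le_left _ _)⟩
  have hNν : ∀ x ∈ Set.Icc 0 L, N x = ν x := by
    intro x hx
    simp only [hNdef]
    rw [min_eq_right hx.2, max_eq_right hx.1]
  have hlip : ∀ x ∈ Set.Icc 0 L, ∀ y ∈ Set.Icc 0 L, ‖γ x - γ y‖ ≤ |x - y| := by
    intro x hx y hy
    have := (convex_Icc 0 L).norm_image_sub_le_of_norm_hasDerivWithin_le hder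
      (fun t ht => (hn2 t ht).le) hy hx
    simpa using this
  have hint2 : ENNReal.ofReal (1 - s) * ∫⁻ x in Set.Icc 0 L, ∫⁻ y in Set.Icc 0 L,
      ENNReal.ofReal (‖N x - N y‖ ^ 2) * ENNReal.ofReal (|x - y| ^ (-2 - s))
      ≤ ENNReal.ofReal (324 * δ) := by
    rw [ENNReal.ofReal_mul (by norm_num)]
    refine le_trans ?_ (mul_le_mul_right hint (ENNReal.ofReal 324))
    rw [mul_left_comm]
    gcongr
    rw [← lintegral_const_mul' _ _ (by simp)]
    apply setLIntegral_mono' measurableSet_Icc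
    intro x hx
    rw [← lintegral_const_mul' _ _ (by simp)]
    apply setLIntegral_mono' measurableSet_Icc
    intro y hy
    rw [hNν x hx, hNν y hy, mul_left_comm]
    gcongr
    have hb : |x - y| ≤ 16 := by
      rw [abs_le]; constructor <;> linarith [hx.1, hx.2, hy.1, hy.2]
    have := kernelK_lower (s := s) (by linarith) hs1 (hn1 x hx) (hn1 y hy) (abs_nonneg (x - y)) hb
      (hlip x hx y hy)
    calc ENNReal.ofReal (|x - y| ^ (-2 - s))
        = ENNReal.ofReal 324 * ENNReal.ofReal (1 / 324 * |x - y| ^ (-2 - s)) := by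
          rw [← ENNReal.ofReal_mul (by norm_num)]; congr 1; ring
      _ ≤ _ := by gcongr
  have hpow : ∀ r : ℝ, 0 ≤ r → r ≤ 16 → r ^ (1 / 4 : ℝ) ≤ 16 := by
    intro r h0 h1
    calc r ^ (1 / 4 : ℝ) ≤ 16 ^ (1 / 4 : ℝ) := Real.rpow_le_rpow h0 h1 (by norm_num)
      _ ≤ 16 ^ (1 : ℝ) := Real.rpow_le_rpow_of_exponent_le (by norm_num) (by norm_num)
      _ = 16 := by norm_num
  have hH : ∀ a b, 0 ≤ a → a ≤ b → b ≤ L →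
      ‖N b - N a‖ ≤ (K * 16) * (b - a) ^ (1 / 4 : ℝ) := by
    intro a b ha hab hb
    have ha' : a ∈ Set.Icc 0 L := ⟨ha, by linarith⟩
    have hb' : b ∈ Set.Icc 0 L := ⟨by linarith, hb⟩
    rw [hNν a ha', hNν b hb']
    have h1 := hK.dist_le_mul b hb' a ha'
    rw [dist_eq_norm, Real.dist_eq, abs_of_nonneg (by linarith)] at h1
    refine h1.trans ?_
    rw [mul_assoc]
    gcongr
    have h0 : 0 ≤ b - a := by linarith
    have h16 : b - a ≤ 16 := by linarith
    set q := (b - a) ^ (1 / 4 : ℝ) with hq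
    have e : b - a = (b - a) ^ (3 / 4 : ℝ) * q := by
      rw [hq, ← Real.rpow_add_of_nonneg h0 (by norm_num) (by norm_num)]; norm_num
    have h2 : (b - a) ^ (3 / 4 : ℝ) ≤ 16 := by
      calc (b - a) ^ (3 / 4 : ℝ) ≤ 16 ^ (3 / 4 : ℝ) := Real.rpow_le_rpow h0 h16 (by norm_num)
        _ ≤ 16 ^ (1 : ℝ) := Real.rpow_le_rpow_of_exponent_le (by norm_num) (by norm_num)
        _ = 16 := by norm_num
    have hq0 : 0 ≤ q := Real.rpow_nonneg h0 _
    calc b - a = (b - a) ^ (3 / 4 : ℝ) * q := e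
      _ ≤ 16 * q := by gcongr
  have hfin := holder_final hNc hL16 hs0 hs1 (by positivity) hint2 hH (by positivity)
  have hsq : √(324 * δ) = 18 * δ ^ (1 / 2 : ℝ) := by
    rw [Real.sqrt_mul (by norm_num), ← Real.sqrt_eq_rpow,
      show (324 : ℝ) = 18 ^ 2 by norm_num, Real.sqrt_sq (by norm_num)]
  rw [hsq] at hfin
  have hd0 : 0 ≤ δ ^ (1 / 2 : ℝ) := Real.rpow_nonneg hδ.le _
  have hall : ∀ t ∈ Set.Icc 0 L, ∀ u ∈ Set.Icc 0 L,
      ‖ν t - ν u‖ ≤ 16384 * (18 * δ ^ (1 / 2 : ℝ)) * |t - u| ^ (1 / 4 : ℝ) := by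
    intro t ht u hu
    rw [← hNν t ht, ← hNν u hu]
    rcases le_total t u with h | h
    · rw [norm_sub_rev, abs_sub_comm, abs_of_nonneg (by linarith)]
      exact hfin t u ht.1 h hu.2
    · rw [abs_of_nonneg (by linarith)]
      exact hfin u t hu.1 h ht.2
  refine ⟨ν 0, ?_, ?_⟩
  · intro t ht
    refine (hall t ht 0 ⟨le_rfl, hL0.le⟩).trans ?_
    have := hpow |t - 0| (abs_nonneg _) (by
      rw [sub_zero, abs_of_nonneg ht.1]; linarith [ht.2])
    calc _ ≤ 16384 * (18 * δ ^ (1 / 2 : ℝ)) * 16 := by gcongr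
      _ = _ := by ring
  · intro t ht u hu
    refine (hall t ht u hu).trans ?_
    have : 0 ≤ |t - u| ^ (1 / 4 : ℝ) := Real.rpow_nonneg (abs_nonneg _) _
    apply mul_le_mul_of_nonneg_right _ this
    linarith
end
end
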